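/- arXiv:math/0507317 — 3 statements merged into one kernel-verified Lean document; each statement's English description precedes it below -/
import Mathlib

section
/- For every f ∈ C_c^∞(ℝⁿ×ℝⁿ) and every smooth compactly supported function K on ℝ^{n−1}×ℝ^{n−1}×ℝ₊×ℝ₊, limsup_{ℏ→0⁺} ‖ρ_ℏ(f) + κ_ℏ(K)‖ ≤ max{ ‖π₀(f)‖ , ‖π₀^∂(f⊕K)‖ }, where the first norm is the operator norm on L²(ℝⁿ₊); i.e., the field ℏ ↦ ρ_ℏ(f)+κ_ℏ(K) is upper semi-continuous in norm at ℏ=0. -/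
open MeasureTheory Filter Topology Set
open scoped ContDiff

noncomputable section

/-- `ℝ^{n−1}`, the boundary directions. -/
abbrev Eb (n : ℕ) : Type := Fin (n - 1) → ℝ

/-- `ℝⁿ` written as `ℝ^{n−1} × ℝ`; a point is `x = (x', xₙ)`. -/
abbrev Ef (n : ℕ) : Type := Eb n × ℝ

/-- Lebesgue measure restricted to the closed half-space `ℝⁿ₊ = {x : xₙ ≥ 0}`. -/
def muPlus (n : ℕ) : Measure (Ef n) := volume.restrict {p : Ef n | 0 ≤ p.2}

/-- `L²(ℝⁿ₊)`. -/
abbrev HS (n : ℕ) := Lp ℂ 2 (muPlus n)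

/-- `T` is the ℏ-scaled truncated operator `ρ_ℏ(f)` on `L²(ℝⁿ₊)`:
`(ρ_ℏ(f)ξ)(x) = ∫_{v : xₙ ≥ ℏvₙ} f(x,v) ξ(x−ℏv) dv`. -/
def rhoSpec (n : ℕ) (ℏ : ℝ) (f : Ef n × Ef n → ℂ) (T : HS n →L[ℂ] HS n) : Prop :=
  ∀ ξ : HS n, ⇑(T ξ) =ᵐ[muPlus n]
    fun x => ∫ v in {v : Ef n | ℏ * v.2 ≤ x.2},
      f (x, v) * (ξ (x.1 - ℏ • v.1, x.2 - ℏ * v.2))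

/-- `S` is the ℏ-scaled Green-type operator `κ_ℏ(K)` on `L²(ℝⁿ₊)`:
`(κ_ℏ(K)ξ)(x',xₙ) = ∫_{ℝ^{n−1}} ∫₀^∞ K(x',y',xₙ/ℏ,yₙ) ξ(x'−ℏy', ℏyₙ) dyₙ dy'`. -/
def kappaSpec (n : ℕ) (ℏ : ℝ) (K : Eb n × Eb n × ℝ × ℝ → ℂ) (S : HS n →L[ℂ] HS n) : Prop :=
  ∀ ξ : HS n, ⇑(S ξ) =ᵐ[muPlus n]
    fun x => ∫ y' : Eb n, ∫ yn in Ioi (0:ℝ),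
      K (x.1, y', x.2 / ℏ, yn) * (ξ (x.1 - ℏ • y', ℏ * yn))

/-- The measure on `ℝⁿ₊ × ℝⁿ` (base point in the half-space, tangent vector free). -/
def muT (n : ℕ) : Measure (Ef n × Ef n) := (muPlus n).prod volume

/-- `L²(ℝⁿ₊ × ℝⁿ)`. -/
abbrev HT (n : ℕ) := Lp ℂ 2 (muT n)

/-- `P` is the fiberwise convolution operator `π₀(f)` on `L²(ℝⁿ₊×ℝⁿ)`:
`(π₀(f)ξ)(x,v) = ∫ f(x,w) ξ(x,v−w) dw`. -/
def pi0Spec (n : ℕ) (f : Ef n × Ef n → ℂ) (P : HT n →L[ℂ] HT n) : Prop :=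
  ∀ ξ : HT n, ⇑(P ξ) =ᵐ[muT n] fun p => ∫ w : Ef n, f (p.1, w) * (ξ (p.1, p.2 - w))

/-- Lebesgue measure on `ℝ^{n−1} × ℝ^{n−1} × ℝ` restricted to `ℝ^{n−1} × ℝ^{n−1} × ℝ₊`. -/
def muB (n : ℕ) : Measure (Eb n × Eb n × ℝ) :=
  volume.restrict {q : Eb n × Eb n × ℝ | 0 ≤ q.2.2}

/-- `L²(ℝ^{n−1} × ℝ^{n−1} × ℝ₊)`. -/
abbrev HB (n : ℕ) := Lp ℂ 2 (muB n)

/-- `B` is the boundary operator `π₀^∂(f⊕K)` on `L²(ℝ^{n−1}×ℝ^{n−1}×ℝ₊)`: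
`(π₀^∂(f⊕K)ξ)(x',v',vₙ) = ∫_{ℝ^{n−1}} ∫₀^∞ [f(x',0,v'−w',vₙ−wₙ) + K(x',v'−w',vₙ,wₙ)]
ξ(x',w',wₙ) dwₙ dw'`. -/
def piBSpec (n : ℕ) (f : Ef n × Ef n → ℂ) (K : Eb n × Eb n × ℝ × ℝ → ℂ)
    (B : HB n →L[ℂ] HB n) : Prop :=
  ∀ ξ : HB n, ⇑(B ξ) =ᵐ[muB n]
    fun q => ∫ w' : Eb n, ∫ wn in Ioi (0:ℝ),
      (f ((q.1, (0:ℝ)), (q.2.1 - w', q.2.2 - wn)) + K (q.1, q.2.1 - w', q.2.2, wn)) *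
        (ξ (q.1, w', wn))

/-- Fiberwise convolution `(f*g)(x,w) = ∫ f(x,v) g(x,w−v) dv`. -/
def fconv (n : ℕ) (f g : Ef n × Ef n → ℂ) : Ef n × Ef n → ℂ :=
  fun p => ∫ v : Ef n, f (p.1, v) * g (p.1, p.2 - v)

/-- The Green symbol `l(f,g)(x',y',xₙ,yₙ) =
−∫_{ℝ^{n−1}} ∫_{xₙ}^∞ f(x',0,y'−v',vₙ) g(x',0,v',xₙ−vₙ−yₙ) dvₙ dv'`. -/
def lGreen (n : ℕ) (f g : Ef n × Ef n → ℂ) : Eb n × Eb n × ℝ × ℝ → ℂ :=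
  fun q => -(∫ v' : Eb n, ∫ vn in Ici q.2.2.1,
    f ((q.1, (0:ℝ)), (q.2.1 - v', vn)) * g ((q.1, (0:ℝ)), (v', q.2.2.1 - vn - q.2.2.2)))


theorem aux_norm_sq {α : Type*} [MeasurableSpace α] {μ : Measure α} (u : Lp ℂ 2 μ) :
    ENNReal.ofReal (‖u‖ ^ 2) = ∫⁻ x, ‖u x‖ₑ ^ 2 ∂μ := by
  have h := eLpNorm_nnreal_pow_eq_lintegral (μ := μ) (f := u) (p := 2) (by norm_num)
  simp only [NNReal.coe_ofNat, ENNReal.rpow_ofNat, ENNReal.coe_ofNat] at h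
  rw [← h, Lp.norm_def, ENNReal.ofReal_pow ENNReal.toReal_nonneg,
    ENNReal.ofReal_toReal (Lp.eLpNorm_ne_top u)]

theorem aux_norm_toLp_sq {α : Type*} [MeasurableSpace α] {μ : Measure α} {u : α → ℂ}
    (hu : MemLp u 2 μ) :
    ENNReal.ofReal (‖hu.toLp u‖ ^ 2) = ∫⁻ x, ‖u x‖ₑ ^ 2 ∂μ := by
  rw [aux_norm_sq]
  refine lintegral_congr_ae ?_
  filter_upwards [hu.coeFn_toLp] with x hx
  rw [hx]

theorem aux_memLp {α : Type*} [MeasurableSpace α] {μ : Measure α} {u : α → ℂ}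
    (hu : AEStronglyMeasurable u μ) (h : ∫⁻ x, ‖u x‖ₑ ^ 2 ∂μ ≠ ⊤) : MemLp u 2 μ := by
  refine ⟨hu, ?_⟩
  have h' := eLpNorm_nnreal_pow_eq_lintegral (μ := μ) (f := u) (p := 2) (by norm_num)
  simp only [NNReal.coe_ofNat, ENNReal.rpow_ofNat, ENNReal.coe_ofNat] at h'
  rw [← h'] at h
  rw [lt_top_iff_ne_top]
  intro h2
  simp [h2] at h

theorem aux_lint_lt_top {α : Type*} [MeasurableSpace α] {μ : Measure α} {u : α → ℂ}
    (hu : MemLp u 2 μ) : ∫⁻ x, ‖u x‖ₑ ^ 2 ∂μ ≠ ⊤ := by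
  rw [← aux_norm_toLp_sq hu]; exact ENNReal.ofReal_ne_top

theorem aux_scale {V : Type*} [NormedAddCommGroup V] [NormedSpace ℝ V] [MeasurableSpace V]
    [BorelSpace V] [FiniteDimensional ℝ V] (m : Measure V) [m.IsAddHaarMeasure] {r : ℝ}
    (hr : r ≠ 0) (g : V → ENNReal) (hg : Measurable g) :
    ∫⁻ v, g (r • v) ∂m = ENNReal.ofReal |(r ^ Module.finrank ℝ V)⁻¹| * ∫⁻ v, g v ∂m := by
  rw [← lintegral_map hg (measurable_const_smul r), Measure.map_addHaar_smul m hr,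
    lintegral_smul_measure, smul_eq_mul]

theorem aux_cs {α : Type*} [MeasurableSpace α] (μ : Measure α) (g : α → ENNReal)
    (hg : AEMeasurable g μ) : (∫⁻ x, g x ∂μ) ^ 2 ≤ μ univ * ∫⁻ x, g x ^ 2 ∂μ := by
  have h := ENNReal.lintegral_mul_le_Lp_mul_Lq μ (p := 2) (q := 2)
    (Real.HolderConjugate.two_two) (f := fun _ => 1) (g := g) aemeasurable_const hg
  simp only [Pi.mul_apply, one_mul, one_pow, lintegral_const,
    ENNReal.rpow_ofNat] at h
  calc (∫⁻ x, g x ∂μ) ^ 2 ≤ ((μ univ) ^ (1/2:ℝ) * (∫⁻ x, g x ^ 2 ∂μ) ^ (1/2:ℝ)) ^ 2 := by gcongr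
    _ = _ := by
      rw [mul_pow, ← ENNReal.rpow_mul_natCast, ← ENNReal.rpow_mul_natCast]; norm_num

/-- The `L²` bound of a truncated kernel operator. -/
theorem aux_D {X V : Type*} [MeasurableSpace X] [NormedAddCommGroup V] [NormedSpace ℝ V]
    [MeasurableSpace V] [BorelSpace V] [FiniteDimensional ℝ V] (m : Measure V)
    [m.IsAddHaarMeasure] (μ : Measure X) [SFinite μ] (ν : Measure V) [SFinite ν] (hν : ν ≤ m)
    {r : ℝ} (hr : r ≠ 0) (G : V → ℂ) (hG : Measurable G) (s : Set V)
    (D : X × V → ℂ) (k : X → V → ENNReal) (hk : Measurable (fun p : X × V => k p.1 p.2))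
    (η : ENNReal) (hkη : ∀ v, ∫⁻ x, k x v ^ 2 ∂μ ≤ η)
    (hD : ∀ᵐ p ∂(μ.prod ν), ‖D p‖ₑ ≤ k p.1 p.2 * ∫⁻ w in s, ‖G (r • (p.2 - w))‖ₑ ∂m) :
    ∫⁻ p, ‖D p‖ₑ ^ 2 ∂(μ.prod ν) ≤
      η * (m s) ^ 2 * (ENNReal.ofReal |(r ^ Module.finrank ℝ V)⁻¹| * ∫⁻ v, ‖G v‖ₑ ^ 2 ∂m) := by
  have hm : Measurable (fun p : V × V => ‖G (r • (p.1 - p.2))‖ₑ) := by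
    apply Measurable.enorm; apply hG.comp; fun_prop
  have hmL : Measurable (fun v => ∫⁻ w in s, ‖G (r • (v - w))‖ₑ ∂m) := hm.lintegral_prod_right
  calc ∫⁻ p, ‖D p‖ₑ ^ 2 ∂(μ.prod ν)
      ≤ ∫⁻ p, k p.1 p.2 ^ 2 * (∫⁻ w in s, ‖G (r • (p.2 - w))‖ₑ ∂m) ^ 2 ∂(μ.prod ν) := by
        apply lintegral_mono_ae
        filter_upwards [hD] with p hp
        rw [← mul_pow]; gcongr
    _ = ∫⁻ v, ∫⁻ x, k x v ^ 2 * (∫⁻ w in s, ‖G (r • (v - w))‖ₑ ∂m) ^ 2 ∂μ ∂ν := by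
        rw [lintegral_prod_symm]
        exact ((hk.pow_const 2).mul ((hmL.comp measurable_snd).pow_const 2)).aemeasurable
    _ ≤ ∫⁻ v, η * (∫⁻ w in s, ‖G (r • (v - w))‖ₑ ∂m) ^ 2 ∂ν := by
        apply lintegral_mono
        intro v
        dsimp only
        rw [lintegral_mul_const]
        · gcongr; exact hkη v
        · exact (hk.comp (measurable_id.prodMk measurable_const)).pow_const 2
    _ ≤ ∫⁻ v, η * (m s * ∫⁻ w in s, ‖G (r • (v - w))‖ₑ ^ 2 ∂m) ∂m := by
        refine (lintegral_mono' hν le_rfl).trans (lintegral_mono fun v => ?_)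
        dsimp only
        gcongr
        have := aux_cs (m.restrict s) (fun w => ‖G (r • (v - w))‖ₑ)
          (hm.comp (measurable_const.prodMk measurable_id)).aemeasurable
        simpa using this
    _ = η * (m s * ∫⁻ w in s, ∫⁻ v, ‖G (r • (v - w))‖ₑ ^ 2 ∂m ∂m) := by
        have hm2 := (hm.pow_const 2).lintegral_prod_right' (ν := m.restrict s)
        rw [lintegral_const_mul _ (hm2.const_mul _), lintegral_const_mul _ hm2,
          lintegral_lintegral_swap (hm.pow_const 2).aemeasurable]
    _ = _ := by
        have : ∀ w, ∫⁻ v, ‖G (r • (v - w))‖ₑ ^ 2 ∂m =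
            ENNReal.ofReal |(r ^ Module.finrank ℝ V)⁻¹| * ∫⁻ v, ‖G v‖ₑ ^ 2 ∂m := by
          intro w
          rw [lintegral_sub_right_eq_self (fun v => ‖G (r • v)‖ₑ ^ 2) w]
          exact aux_scale m hr (fun v => ‖G v‖ₑ ^ 2) (hG.enorm.pow_const 2)
        simp_rw [this]
        simp only [lintegral_const, Measure.restrict_apply MeasurableSet.univ, univ_inter]
        ring

theorem aux_iso {X V : Type*} [MeasurableSpace X] [MeasurableSpace V]
    (μ : Measure X) [SFinite μ] (ν : Measure V) [SFinite ν]
    (ψ : X → V → ℂ) (hψ : Measurable (fun p : X × V => ψ p.1 p.2)) (F : V → ℂ) (hF : Measurable F)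
    (h : ∀ᵐ v ∂ν, F v ≠ 0 → ∫⁻ x, ‖ψ x v‖ₑ ^ 2 ∂μ = 1) :
    ∫⁻ p, ‖ψ p.1 p.2 * F p.2‖ₑ ^ 2 ∂(μ.prod ν) = ∫⁻ v, ‖F v‖ₑ ^ 2 ∂ν := by
  rw [lintegral_prod_symm _ (by
    exact ((hψ.mul (hF.comp measurable_snd)).enorm.pow_const 2).aemeasurable)]
  refine lintegral_congr_ae ?_
  filter_upwards [h] with v hv
  simp only [enorm_mul, mul_pow]
  rw [lintegral_mul_const]
  · by_cases h0 : F v = 0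
    · simp [h0]
    · rw [hv h0, one_mul]
  · exact ((hψ.comp (measurable_id.prodMk measurable_const)).enorm.pow_const 2)

/-- Core comparison. -/
theorem aux_core {X V : Type*} [MeasurableSpace X] [NormedAddCommGroup V] [NormedSpace ℝ V]
    [MeasurableSpace V] [BorelSpace V] [FiniteDimensional ℝ V] (m : Measure V)
    [m.IsAddHaarMeasure] (μ : Measure X) [SFinite μ] (ν : Measure V) [SFinite ν] (hν : ν ≤ m)
    {r : ℝ} (hr : r ≠ 0) (G : V → ℂ) (hG : Measurable G) (s : Set V) (hs : MeasurableSet s)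
    (mp : Measure (X × V)) (hmp : mp = μ.prod ν) (u U : X × V → ℂ) (hu : MemLp u 2 mp) (hU : MemLp U 2 mp)
    (Q : Lp ℂ 2 mp →L[ℂ] Lp ℂ 2 mp)
    (a : V → V → ℂ) (b : X → V → V → ℂ) (ψ : X → V → ℂ)
    (hQ : ∀ᵐ p ∂mp, (Q (hu.toLp u)) p =
      ∫ w, b p.1 p.2 w * (ψ p.1 (r • (p.2 - w)) * G (r • (p.2 - w))) ∂m)
    (hUe : ∀ᵐ p ∂mp, U p = ψ p.1 (r • p.2) * ∫ w, a p.2 w * G (r • (p.2 - w)) ∂m)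
    (i1 : ∀ v, Integrable (fun w => a v w * G (r • (v - w))) m)
    (i2 : ∀ x v, Integrable (fun w => b x v w * (ψ x (r • (v - w)) * G (r • (v - w)))) m)
    (k : X → V → ENNReal) (hk : Measurable (fun p : X × V => k p.1 p.2))
    (η : ENNReal) (hη : η ≠ ⊤) (hms : m s ≠ ⊤) (hGfin : ∫⁻ v, ‖G v‖ₑ ^ 2 ∂m ≠ ⊤)
    (hkη : ∀ v, ∫⁻ x, k x v ^ 2 ∂μ ≤ η)
    (hd : ∀ᵐ p ∂mp, ∀ w,
      ‖ψ p.1 (r • p.2) * a p.2 w - b p.1 p.2 w * ψ p.1 (r • (p.2 - w))‖ₑ ≤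
        s.indicator (fun _ => k p.1 p.2) w) :
    ‖hU.toLp U‖ ≤ ‖Q‖ * ‖hu.toLp u‖ +
      √((η * (m s) ^ 2 *
        (ENNReal.ofReal |(r ^ Module.finrank ℝ V)⁻¹| * ∫⁻ v, ‖G v‖ₑ ^ 2 ∂m)).toReal) := by
  subst hmp
  have key : ∫⁻ p, ‖(hU.toLp U - Q (hu.toLp u) : Lp ℂ 2 (μ.prod ν)) p‖ₑ ^ 2 ∂(μ.prod ν) ≤
      η * (m s) ^ 2 * (ENNReal.ofReal |(r ^ Module.finrank ℝ V)⁻¹| * ∫⁻ v, ‖G v‖ₑ ^ 2 ∂m) := by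
    refine aux_D m μ ν hν hr G hG s _ k hk η hkη ?_
    filter_upwards [hQ, hUe, hd, Lp.coeFn_sub (hU.toLp U) (Q (hu.toLp u)), hU.coeFn_toLp]
      with p h1 h2 h3 h4 h5
    rw [h4, Pi.sub_apply, h5, h1, h2, ← integral_const_mul,
      ← integral_sub ((i1 p.2).const_mul _) (i2 p.1 p.2)]
    refine (enorm_integral_le_lintegral_enorm _).trans ?_
    have hmm : Measurable (fun w => ‖G (r • (p.2 - w))‖ₑ) := by
      apply Measurable.enorm; apply hG.comp; fun_prop
    rw [← lintegral_const_mul _ hmm, ← lintegral_indicator hs]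
    refine lintegral_mono fun w => ?_
    have e : ψ p.1 (r • p.2) * (a p.2 w * G (r • (p.2 - w))) -
        b p.1 p.2 w * (ψ p.1 (r • (p.2 - w)) * G (r • (p.2 - w))) =
        (ψ p.1 (r • p.2) * a p.2 w - b p.1 p.2 w * ψ p.1 (r • (p.2 - w))) *
          G (r • (p.2 - w)) := by ring
    dsimp only
    rw [e, enorm_mul]
    refine (mul_le_mul_left (h3 w) _).trans ?_
    by_cases hw : w ∈ s <;> simp [hw]
  rw [← aux_norm_sq] at key
  have h1 : ‖hU.toLp U - Q (hu.toLp u)‖ ≤ √((η * (m s) ^ 2 *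
        (ENNReal.ofReal |(r ^ Module.finrank ℝ V)⁻¹| * ∫⁻ v, ‖G v‖ₑ ^ 2 ∂m)).toReal) := by
    apply Real.le_sqrt_of_sq_le
    rw [← ENNReal.ofReal_le_iff_le_toReal]
    · exact key
    · exact ENNReal.mul_ne_top (ENNReal.mul_ne_top hη (ENNReal.pow_ne_top hms))
        (ENNReal.mul_ne_top ENNReal.ofReal_ne_top hGfin)
  calc ‖hU.toLp U‖ = ‖Q (hu.toLp u) + (hU.toLp U - Q (hu.toLp u))‖ := by congr 1; abel
    _ ≤ _ := (norm_add_le _ _).trans (add_le_add (Q.le_opNorm _) h1)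

/-- A Lipschitz bump with `L²` norm one supported in a ball. -/
theorem aux_bump {E : Type*} [NormedAddCommGroup E] [NormedSpace ℝ E] [MeasurableSpace E]
    [BorelSpace E] [FiniteDimensional ℝ E] (m : Measure E) [m.IsAddHaarMeasure]
    (c : E) (r : ℝ) (hr : 0 < r) :
    ∃ (φ : E → ℝ) (N : ℝ), 0 ≤ N ∧ (∀ x y, |φ x - φ y| ≤ N * ‖x - y‖) ∧ (∀ x, |φ x| ≤ N) ∧
      Continuous φ ∧ (∀ x, φ x ≠ 0 → ‖x - c‖ < r) ∧ ∫⁻ x, ‖φ x‖ₑ ^ 2 ∂m = 1 := by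
  set φ₀ : E → ℝ := fun x => max 0 (r - ‖x - c‖) with hφ₀
  have hc : Continuous φ₀ := by fun_prop
  have hsupp : ∀ x, φ₀ x ≠ 0 → ‖x - c‖ < r := by
    intro x hx
    by_contra h
    exact hx (max_eq_left (by linarith))
  have hcs : HasCompactSupport (fun x => φ₀ x ^ 2) := by
    refine HasCompactSupport.intro (isCompact_closedBall c r) fun x hx => ?_
    by_contra h
    have := hsupp x (fun h' => h (by simp [h']))
    exact hx (by rw [mem_closedBall_iff_norm]; exact this.le)
  have hpos : 0 < ∫ x, φ₀ x ^ 2 ∂m :=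
    (hc.pow 2).integral_pos_of_hasCompactSupport_nonneg_nonzero (x := c) hcs
      (fun x => sq_nonneg _) (by simp [hφ₀, hr.le, hr.ne'])
  set I := ∫ x, φ₀ x ^ 2 ∂m with hI
  have hintg : Integrable (fun x => φ₀ x ^ 2) m := (hc.pow 2).integrable_of_hasCompactSupport hcs
  set q := (√I)⁻¹ with hq
  have hq0 : 0 ≤ q := by positivity
  have hlip : ∀ x y, |φ₀ x - φ₀ y| ≤ ‖x - y‖ := by
    intro x y
    have h1 : |φ₀ x - φ₀ y| ≤ |(r - ‖x - c‖) - (r - ‖y - c‖)| := by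
      have := abs_max_sub_max_le_max 0 (r - ‖x - c‖) 0 (r - ‖y - c‖)
      simpa [hφ₀] using this
    refine h1.trans ?_
    have := abs_norm_sub_norm_le (y - c) (x - c)
    rw [show (y - c) - (x - c) = y - x by abel, norm_sub_rev y x] at this
    rwa [show (r - ‖x - c‖) - (r - ‖y - c‖) = ‖y - c‖ - ‖x - c‖ by ring]
  refine ⟨fun x => q * φ₀ x, q * (1 + r), by positivity, ?_, ?_, by fun_prop, ?_, ?_⟩
  · intro x y
    rw [← mul_sub, abs_mul, abs_of_nonneg hq0, mul_assoc]
    gcongr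
    refine (hlip x y).trans ?_
    nlinarith [norm_nonneg (x - y)]
  · intro x
    rw [abs_mul, abs_of_nonneg hq0]
    gcongr
    rw [abs_of_nonneg (le_max_left _ _)]
    apply max_le <;> linarith [norm_nonneg (x - c)]
  · intro x hx
    exact hsupp x (right_ne_zero_of_mul hx)
  · have : ∀ x, ‖q * φ₀ x‖ₑ ^ 2 = ENNReal.ofReal (q ^ 2 * φ₀ x ^ 2) := by
      intro x
      rw [Real.enorm_eq_ofReal_abs, ← ENNReal.ofReal_pow (abs_nonneg _), sq_abs, mul_pow]
    simp_rw [this]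
    rw [← ofReal_integral_eq_lintegral_ofReal (hintg.const_mul _)
      (Eventually.of_forall fun x => by positivity), integral_const_mul, ← hI, hq, inv_pow,
      Real.sq_sqrt hpos.le, inv_mul_cancel₀ hpos.ne', ENNReal.ofReal_one]

theorem aux_cut (δ : ℝ) (hδ : 0 < δ) :
    ∃ (χi χb : ℝ → ℝ) (L : ℝ), 0 ≤ L ∧ Continuous χi ∧ Continuous χb ∧
      (∀ s t, |χi s - χi t| ≤ L * |s - t|) ∧ (∀ s t, |χb s - χb t| ≤ L * |s - t|) ∧
      (∀ t, χi t ^ 2 + χb t ^ 2 = 1) ∧ (∀ t, t ≤ δ → χi t = 0) ∧ (∀ t, 3 * δ ≤ t → χb t = 0) := by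
  set θ : ℝ → ℝ := fun t => min (max 0 (t / δ - 1)) (Real.pi / 2) with hθ
  have hθc : Continuous θ := by fun_prop
  have hl : ∀ s t, |θ s - θ t| ≤ δ⁻¹ * |s - t| := by
    intro s t
    have h1 := abs_min_sub_min_le_max (max 0 (s / δ - 1)) (Real.pi / 2) (max 0 (t / δ - 1))
      (Real.pi / 2)
    have h2 := abs_max_sub_max_le_max 0 (s / δ - 1) 0 (t / δ - 1)
    simp only [sub_self, abs_zero] at h1 h2
    rw [max_eq_left (a := |_|) (abs_nonneg _)] at h1
    rw [max_eq_right (b := |_|) (abs_nonneg _)] at h2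
    refine (h1.trans h2).trans (le_of_eq ?_)
    rw [show s / δ - 1 - (t / δ - 1) = δ⁻¹ * (s - t) by field_simp; ring, abs_mul,
      abs_of_pos (inv_pos.2 hδ)]
  refine ⟨fun t => Real.sin (θ t), fun t => Real.cos (θ t), δ⁻¹, by positivity, by fun_prop,
    by fun_prop, ?_, ?_, ?_, ?_, ?_⟩
  · intro s t
    exact (Real.abs_sin_sub_sin_le _ _).trans (hl s t)
  · intro s t
    exact (Real.abs_cos_sub_cos_le _ _).trans (hl s t)
  · intro t; exact Real.sin_sq_add_cos_sq _
  · intro t ht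
    have : t / δ ≤ 1 := by rwa [div_le_one hδ]
    have : θ t = 0 := by
      simp only [hθ]
      rw [max_eq_left (by linarith), min_eq_left (by positivity)]
    simp [this]
  · intro t ht
    have h3 : 3 ≤ t / δ := by rwa [le_div_iff₀ hδ]
    have : θ t = Real.pi / 2 := by
      simp only [hθ]
      apply min_eq_right
      exact le_max_of_le_right (by linarith [Real.pi_lt_four])
    simp [this]

/-- The dominating kernel. -/
def kker {E : Type*} [NormedAddCommGroup E] (φ : E → ℝ) (ε₁ ε₂ : ℝ) (s : E) : ENNReal :=
  ENNReal.ofReal ε₁ * ‖φ s‖ₑ + (Metric.closedBall (0 : E) 2).indicator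
    (fun _ => ENNReal.ofReal ε₂) s

theorem kker_meas {E : Type*} [NormedAddCommGroup E] [MeasurableSpace E] [BorelSpace E]
    (φ : E → ℝ) (hφ : Continuous φ) (ε₁ ε₂ : ℝ) : Measurable (kker φ ε₁ ε₂) := by
  unfold kker
  exact (hφ.measurable.enorm.const_mul _).add
    (measurable_const.indicator Metric.isClosed_closedBall.measurableSet)

theorem kker_bound {E : Type*} [NormedAddCommGroup E] [NormedSpace ℝ E] [MeasurableSpace E]
    [BorelSpace E] [FiniteDimensional ℝ E] (m : Measure E) [m.IsAddHaarMeasure]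
    (φ : E → ℝ) (hφ : Continuous φ) (h1 : ∫⁻ x, ‖φ x‖ₑ ^ 2 ∂m = 1) (ε₁ ε₂ : ℝ) (y : E) :
    ∫⁻ x, kker φ ε₁ ε₂ (x - y) ^ 2 ∂m ≤ 2 * ENNReal.ofReal ε₁ ^ 2 +
      2 * ENNReal.ofReal ε₂ ^ 2 * m (Metric.closedBall (0 : E) 2) := by
  rw [lintegral_sub_right_eq_self (fun x => kker φ ε₁ ε₂ x ^ 2) y]
  have hms : MeasurableSet (Metric.closedBall (0 : E) 2) := Metric.isClosed_closedBall.measurableSet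
  calc ∫⁻ x, kker φ ε₁ ε₂ x ^ 2 ∂m
      ≤ ∫⁻ x, (2 * ENNReal.ofReal ε₁ ^ 2 * ‖φ x‖ₑ ^ 2 + (Metric.closedBall (0 : E) 2).indicator
        (fun _ => 2 * ENNReal.ofReal ε₂ ^ 2) x) ∂m := by
        refine lintegral_mono fun x => ?_
        unfold kker
        refine (add_sq_le_two_mul _ _).trans ?_
        by_cases hx : x ∈ Metric.closedBall (0 : E) 2
        · simp only [hx, indicator_of_mem, mul_pow]
          rw [mul_add, mul_assoc]
        · simp only [hx, indicator_of_notMem, mul_pow, not_false_eq_true]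
          simp [mul_assoc]
    _ = _ := by
        rw [lintegral_add_left ((hφ.measurable.enorm.pow_const 2).const_mul _),
          lintegral_const_mul _ (hφ.measurable.enorm.pow_const 2), h1, mul_one,
          lintegral_indicator_const hms]
where
  add_sq_le_two_mul (a b : ENNReal) : (a + b) ^ 2 ≤ 2 * (a ^ 2 + b ^ 2) := by
    have := ENNReal.inner_le_Lp_mul_Lq (Finset.univ : Finset (Fin 2)) ![a, b] ![1, 1]
      (Real.HolderConjugate.two_two)
    simp only [Fin.sum_univ_two, Matrix.cons_val_zero, Matrix.cons_val_one, mul_one,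
      ENNReal.rpow_ofNat, one_pow, one_add_one_eq_two] at this
    calc (a + b) ^ 2 ≤ ((a ^ 2 + b ^ 2) ^ (1/2:ℝ) * 2 ^ (1/2:ℝ)) ^ 2 := by gcongr
      _ = _ := by
        rw [mul_pow, ← ENNReal.rpow_mul_natCast, ← ENNReal.rpow_mul_natCast]; norm_num
        ring

/-- Pointwise bound of the kernel of the commutator. -/
theorem aux_pt {E : Type*} [NormedAddCommGroup E] (φ : E → ℝ) (χ : ℝ → ℝ) (N L M ε₁ ε₂ ζ : ℝ)
    (hL : 0 ≤ L) (hN : 0 ≤ N) (hε₁ : 0 ≤ ε₁)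
    (hφ : ∀ x y, |φ x - φ y| ≤ N * ‖x - y‖) (hφN : ∀ x, |φ x| ≤ N)
    (hφs : ∀ x, φ x ≠ 0 → ‖x‖ ≤ 1) (hχ : ∀ s t, |χ s - χ t| ≤ L * |s - t|)
    (hχ1 : ∀ t, |χ t| ≤ 1) (s z : E) (t τ : ℝ) (hz : ‖z‖ ≤ ζ) (hτ : |τ| ≤ ζ) (hζ : ζ ≤ 1)
    (hsmall : M * (N * (L + 1) * ζ) ≤ ε₂) (a b : ℂ) (hb : ‖b‖ ≤ M)
    (hab : φ s ≠ 0 → χ t ≠ 0 → ‖a - b‖ ≤ ε₁) :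
    ‖((φ s * χ t : ℝ) : ℂ) * a - b * ((φ (s + z) * χ (t - τ) : ℝ) : ℂ)‖ₑ ≤ kker φ ε₁ ε₂ s := by
  have hM : 0 ≤ M := (norm_nonneg _).trans hb
  have hζ0 : 0 ≤ ζ := (norm_nonneg _).trans hz
  have hε₂ : 0 ≤ ε₂ := le_trans (by positivity) hsmall
  have e : ((φ s * χ t : ℝ) : ℂ) * a - b * ((φ (s + z) * χ (t - τ) : ℝ) : ℂ) =
      ((φ s * χ t : ℝ) : ℂ) * (a - b) +
        b * ((φ s * χ t - φ (s + z) * χ (t - τ) : ℝ) : ℂ) := by push_cast; ring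
  rw [e]
  refine (enorm_add_le _ _).trans ?_
  unfold kker
  refine add_le_add ?_ ?_
  · rw [← ofReal_norm, ← ofReal_norm, ← ENNReal.ofReal_mul hε₁]
    apply ENNReal.ofReal_le_ofReal
    rw [norm_mul, Complex.norm_real, norm_mul, Real.norm_eq_abs, Real.norm_eq_abs]
    by_cases h1 : φ s = 0
    · simp [h1]
    by_cases h2 : χ t = 0
    · simp [h2]; positivity
    have h3 := hab h1 h2
    have h4 := hχ1 t
    calc |φ s| * |χ t| * ‖a - b‖ ≤ |φ s| * 1 * ε₁ := by gcongr
      _ = _ := by ring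
  · by_cases hs : s ∈ Metric.closedBall (0 : E) 2
    · rw [indicator_of_mem hs, ← ofReal_norm]
      apply ENNReal.ofReal_le_ofReal
      refine le_trans ?_ hsmall
      rw [norm_mul, Complex.norm_real, Real.norm_eq_abs]
      gcongr
      have e2 : φ s * χ t - φ (s + z) * χ (t - τ) =
        φ s * (χ t - χ (t - τ)) + (φ s - φ (s + z)) * χ (t - τ) := by ring
      rw [e2]
      refine (abs_add_le _ _).trans ?_
      rw [abs_mul, abs_mul]
      have h1 := hχ t (t - τ)
      have h2 := hφ s (s + z)
      rw [sub_sub_cancel] at h1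
      rw [sub_add_cancel_left, norm_neg] at h2
      calc |φ s| * |χ t - χ (t - τ)| + |φ s - φ (s + z)| * |χ (t - τ)|
          ≤ N * (L * ζ) + N * ζ * 1 := by
            gcongr
            · exact hφN s
            · exact h1.trans (by gcongr)
            · exact h2.trans (by gcongr)
            · exact hχ1 _
        _ = _ := by ring
    · rw [mem_closedBall_zero_iff, not_le] at hs
      have h1 : φ s = 0 := by
        by_contra h; linarith [hφs s h]
      have h2 : φ (s + z) = 0 := by
        by_contra h
        have := hφs _ h
        have h3 := norm_sub_le (s + z) z
        rw [add_sub_cancel_right] at h3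
        linarith
      simp [h1, h2]

instance aux_haar (n : ℕ) : (volume : Measure (Ef n)).IsAddHaarMeasure :=
  Measure.prod.instIsAddHaarMeasure (volume : Measure (Eb n)) (volume : Measure ℝ)

instance aux_sf (n : ℕ) : SFinite (muPlus n) := by unfold muPlus; infer_instance

theorem aux_half_meas (n : ℕ) : MeasurableSet {p : Ef n | 0 ≤ p.2} :=
  measurableSet_le measurable_const measurable_snd

theorem aux_muPlus_eq (n : ℕ) :
    muPlus n = (volume : Measure (Eb n)).prod (volume.restrict (Ioi (0:ℝ))) := by
  have h : (volume.restrict (Ioi (0:ℝ))) = volume.restrict (Ici (0:ℝ)) :=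
    Measure.restrict_congr_set Ioi_ae_eq_Ici
  rw [h]
  conv_rhs => rw [← Measure.restrict_univ (μ := (volume : Measure (Eb n)))]
  rw [Measure.prod_restrict]
  unfold muPlus
  congr 1
  ext p; simp

theorem aux_muB_eq (n : ℕ) : muB n = (volume : Measure (Eb n)).prod (muPlus n) := by
  unfold muPlus muB
  conv_rhs => rw [← Measure.restrict_univ (μ := (volume : Measure (Eb n)))]
  rw [Measure.prod_restrict]
  congr 1
  ext p; simp

theorem aux_int_muPlus {n : ℕ} (F : Ef n → ℂ) (h0 : ∀ y : Ef n, y.2 < 0 → F y = 0) :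
    ∫ y, F y ∂(muPlus n) = ∫ y, F y := by
  unfold muPlus
  apply setIntegral_eq_integral_of_forall_compl_eq_zero
  intro y hy
  exact h0 y (by simpa using hy)

theorem aux_lint_muPlus {n : ℕ} (F : Ef n → ENNReal) (h0 : ∀ y : Ef n, y.2 < 0 → F y = 0) :
    ∫⁻ y, F y ∂(muPlus n) = ∫⁻ y, F y := by
  unfold muPlus
  rw [← lintegral_indicator (aux_half_meas n)]
  congr 1
  ext y
  by_cases hy : 0 ≤ y.2
  · simp [hy]
  · simp [h0 y (not_le.1 hy)]

theorem aux_iter {n : ℕ} (F : Ef n → ℂ) (hF : Integrable F) (h0 : ∀ y : Ef n, y.2 < 0 → F y = 0) :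
    ∫ y' : Eb n, ∫ yn in Ioi (0:ℝ), F (y', yn) = ∫ y, F y := by
  rw [← aux_int_muPlus F h0, aux_muPlus_eq, integral_prod]
  rw [← aux_muPlus_eq]
  exact hF.restrict

theorem aux_int {V : Type*} [NormedAddCommGroup V] [NormedSpace ℝ V] [MeasurableSpace V]
    [BorelSpace V] [FiniteDimensional ℝ V] (m : Measure V) [m.IsAddHaarMeasure]
    (k F : V → ℂ) (R : ℝ) (hk : Continuous k) (hkR : ∀ w, k w ≠ 0 → ‖w‖ ≤ R)
    (hF : MemLp F 2 m) : Integrable (fun w => k w * F w) m := by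
  have hc : HasCompactSupport k := by
    refine HasCompactSupport.intro (isCompact_closedBall 0 R) fun x hx => ?_
    by_contra h
    exact hx (by simpa using hkR x h)
  have hk2 : MemLp k 2 m := hk.memLp_of_hasCompactSupport hc
  exact hk2.integrable_mul hF

theorem aux_memLp_comp {V : Type*} [NormedAddCommGroup V] [NormedSpace ℝ V] [MeasurableSpace V]
    [BorelSpace V] [FiniteDimensional ℝ V] (m : Measure V) [m.IsAddHaarMeasure]
    (G : V → ℂ) (hGm : Measurable G) (hG : ∫⁻ y, ‖G y‖ₑ ^ 2 ∂m ≠ ⊤) {r : ℝ} (hr : r ≠ 0) (v : V) :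
    MemLp (fun w => G (r • (v - w))) 2 m := by
  apply aux_memLp
  · apply Measurable.aestronglyMeasurable; apply hGm.comp; fun_prop
  · rw [lintegral_sub_left_eq_self (fun w => ‖G (r • w)‖ₑ ^ 2) v,
      aux_scale m hr (fun w => ‖G w‖ₑ ^ 2) (hGm.enorm.pow_const 2)]
    exact ENNReal.mul_ne_top ENNReal.ofReal_ne_top hG

/-- The symbol of `ρ_ℏ(f)+κ_ℏ(K)`, at the base point `y`, boundary variable `s`. -/
def symb {n : ℕ} (f : Ef n × Ef n → ℂ) (K : Eb n × Eb n × ℝ × ℝ → ℂ) (y : Ef n) (s : ℝ)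
    (w : Ef n) : ℂ := f (y, w) + K (y.1, w.1, s, s - w.2)

/-- Reflection of the last coordinate. -/
def reflE (n : ℕ) (c : ℝ) : Ef n ≃ᵐ Ef n :=
  MeasurableEquiv.prodCongr (MeasurableEquiv.refl (Eb n)) (MeasurableEquiv.subLeft c)

theorem reflE_apply (n : ℕ) (c : ℝ) (w : Ef n) : reflE n c w = (w.1, c - w.2) := rfl

theorem reflE_mp (n : ℕ) (c : ℝ) : MeasurePreserving (reflE n c) volume volume := by
  have h := (MeasurePreserving.id (volume : Measure (Eb n))).prod
    (Measure.measurePreserving_sub_left (volume : Measure ℝ) c)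
  exact h

theorem aux_A {n : ℕ} {ℏ : ℝ} (hℏ : 0 < ℏ) (f : Ef n × Ef n → ℂ) (K : Eb n × Eb n × ℝ × ℝ → ℂ)
    (hf : Continuous f) (hK : Continuous K) (R : ℝ) (hfR : ∀ x w, f (x, w) ≠ 0 → ‖w‖ ≤ R)
    (hKR : ∀ (x' w' : Eb n) s t, K (x', w', s, s - t) ≠ 0 → ‖((w', t) : Ef n)‖ ≤ R)
    (T S : HS n →L[ℂ] HS n) (hT : rhoSpec n ℏ f T) (hS : kappaSpec n ℏ K S) (ξ : HS n)
    (G : Ef n → ℂ) (hG : G = {p : Ef n | 0 ≤ p.2}.indicator ξ) (hGm : Measurable G)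
    (hGf : ∫⁻ y, ‖G y‖ₑ ^ 2 ≠ ⊤) :
    ∀ᵐ x ∂(muPlus n), ((T + S) ξ : HS n) x =
      ∫ w, symb f K x (x.2 / ℏ) w * G (x - ℏ • w) := by
  filter_upwards [hT ξ, hS ξ, Lp.coeFn_add (T ξ) (S ξ)] with x h1 h2 h3
  have hG0 : ∀ y : Ef n, y.2 < 0 → G y = 0 := by
    intro y hy; rw [hG, indicator_of_notMem]; simpa using hy
  have hG1 : ∀ y : Ef n, 0 ≤ y.2 → G y = ξ y := by
    intro y hy; rw [hG, indicator_of_mem]; simpa using hy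
  have hmem : MemLp (fun w => G (x - ℏ • w)) 2 volume := by
    have := aux_memLp_comp volume G hGm hGf hℏ.ne' (ℏ⁻¹ • x)
    simpa only [smul_sub, smul_inv_smul₀ hℏ.ne'] using this
  have i1 : Integrable (fun w => f (x, w) * G (x - ℏ • w)) :=
    aux_int volume _ _ R (by fun_prop) (fun w hw => hfR x w hw) hmem
  have i2 : Integrable (fun w : Ef n => K (x.1, w.1, x.2 / ℏ, x.2 / ℏ - w.2) * G (x - ℏ • w)) :=
    aux_int volume _ _ R (by fun_prop) (fun w hw => hKR _ _ _ _ hw) hmem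
  have e0 : ((T + S) ξ : HS n) x = (T ξ) x + (S ξ) x := by
    rw [add_apply, h3, Pi.add_apply]
  rw [e0, h1, h2]
  unfold symb
  simp_rw [add_mul]
  rw [integral_add i1 i2]
  congr 1
  · rw [← integral_indicator (measurableSet_le (by fun_prop) (by fun_prop))]
    congr 1
    ext w
    by_cases hw : ℏ * w.2 ≤ x.2
    · rw [indicator_of_mem (by exact hw), hG1 _ (by simpa using hw)]
      rfl
    · rw [indicator_of_notMem (by exact hw), hG0 _ (by simpa using hw), mul_zero]
  · set F : Ef n → ℂ := fun y => K (x.1, y.1, x.2 / ℏ, y.2) * G (x.1 - ℏ • y.1, ℏ * y.2) with hF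
    have hcomp : (fun w : Ef n => K (x.1, w.1, x.2 / ℏ, x.2 / ℏ - w.2) * G (x - ℏ • w)) =
        fun w => F (reflE n (x.2 / ℏ) w) := by
      ext w
      rw [reflE_apply, hF]
      have : x - ℏ • w = (x.1 - ℏ • w.1, ℏ * (x.2 / ℏ - w.2)) := by
        ext
        · simp
        · simp; field_simp
      simp only [this]
    rw [hcomp] at i2 ⊢
    have hFi : Integrable F :=
      ((reflE_mp n (x.2 / ℏ)).integrable_comp_emb (reflE n _).measurableEmbedding).1 i2
    rw [(reflE_mp n (x.2 / ℏ)).integral_comp' F, ← aux_iter F hFi]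
    · congr 1
      ext y'
      apply setIntegral_congr_fun measurableSet_Ioi
      intro yn hyn
      simp only [hF]
      rw [hG1]
      exact mul_nonneg hℏ.le (le_of_lt hyn)
    · intro y hy
      simp only [hF]
      rw [hG0, mul_zero]
      exact mul_neg_of_pos_of_neg hℏ hy

theorem aux_P {n : ℕ} (f : Ef n × Ef n → ℂ) (P : HT n →L[ℂ] HT n) (hP : pi0Spec n f P)
    (u : Ef n × Ef n → ℂ) (hu : MemLp u 2 (muT n)) :
    ∀ᵐ p ∂(muT n), (P (hu.toLp u)) p = ∫ w : Ef n, f (p.1, w) * u (p.1, p.2 - w) := by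
  have h1 : ∀ᵐ p ∂((muPlus n).prod (volume : Measure (Ef n))), (hu.toLp u) p = u p :=
    hu.coeFn_toLp
  have h2 := Measure.ae_ae_of_ae_prod h1
  have h3 : ∀ᵐ p ∂(muT n), ∀ᵐ y : Ef n, (hu.toLp u) (p.1, y) = u (p.1, y) :=
    Measure.quasiMeasurePreserving_fst.ae h2
  filter_upwards [hP (hu.toLp u), h3] with p h4 h5
  rw [h4]
  apply integral_congr_ae
  have h6 := (quasiMeasurePreserving_sub_left (volume : Measure (Ef n)) p.2).ae h5
  filter_upwards [h6] with w hw
  rw [hw]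

theorem aux_B {n : ℕ} (f : Ef n × Ef n → ℂ) (K : Eb n × Eb n × ℝ × ℝ → ℂ)
    (B : HB n →L[ℂ] HB n) (hB : piBSpec n f K B)
    (u : Eb n × Ef n → ℂ) (hu : MemLp u 2 (muB n)) (hu0 : ∀ x v, v.2 < 0 → u (x, v) = 0)
    (hi : ∀ x v, Integrable (fun w => symb f K (x, 0) v.2 w * u (x, v - w))) :
    ∀ᵐ p ∂(muB n), (B (hu.toLp u)) p =
      ∫ w : Ef n, symb f K (p.1, 0) p.2.2 w * u (p.1, p.2 - w) := by
  have h1 : ∀ᵐ p ∂((volume : Measure (Eb n)).prod (muPlus n)), (hu.toLp u) p = u p := by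
    rw [← aux_muB_eq]; exact hu.coeFn_toLp
  have h2 := Measure.ae_ae_of_ae_prod h1
  have h3 : ∀ᵐ p ∂(muB n), ∀ᵐ y ∂(muPlus n), (hu.toLp u) (p.1, y) = u (p.1, y) := by
    have hfst : Measure.QuasiMeasurePreserving (Prod.fst : Eb n × Ef n → Eb n) (muB n) volume := by
      rw [aux_muB_eq]; exact Measure.quasiMeasurePreserving_fst
    exact hfst.ae h2
  filter_upwards [hB (hu.toLp u), h3] with p h4 h5
  rw [h4]
  rw [aux_muPlus_eq] at h5
  have h6 := Measure.ae_ae_of_ae_prod h5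
  rw [← integral_sub_left_eq_self (fun w => symb f K (p.1, 0) p.2.2 w * u (p.1, p.2 - w))
    volume p.2]
  have hi' := (hi p.1 p.2).comp_sub_left p.2
  simp only [sub_sub_cancel] at hi' ⊢
  rw [← aux_iter _ hi' (fun y hy => by rw [hu0 _ _ hy, mul_zero])]
  apply integral_congr_ae
  filter_upwards [h6] with w' hw'
  apply integral_congr_ae
  filter_upwards [hw'] with wn hwn
  rw [hwn]
  simp only [symb, Prod.snd_sub, Prod.fst_sub, sub_sub_cancel]
  rfl

theorem kker_bound' {E : Type*} [NormedAddCommGroup E] [NormedSpace ℝ E] [MeasurableSpace E]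
    [BorelSpace E] [FiniteDimensional ℝ E] (m : Measure E) [m.IsAddHaarMeasure]
    (φ : E → ℝ) (hφ : Continuous φ) (h1 : ∫⁻ x, ‖φ x‖ₑ ^ 2 ∂m = 1) (ε₁ ε₂ η : ℝ)
    (hε₁ : 0 ≤ ε₁) (hε₂ : 0 ≤ ε₂) (he1 : ε₁ ^ 2 ≤ η / 4)
    (he2 : ε₂ ^ 2 * (m (Metric.closedBall (0 : E) 2)).toReal ≤ η / 4) (y : E) :
    ∫⁻ x, kker φ ε₁ ε₂ (x - y) ^ 2 ∂m ≤ ENNReal.ofReal η := by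
  refine (kker_bound m φ hφ h1 ε₁ ε₂ y).trans ?_
  have hfin : m (Metric.closedBall (0 : E) 2) ≠ ⊤ := (isCompact_closedBall _ _).measure_ne_top
  rw [← ENNReal.ofReal_toReal hfin, ← ENNReal.ofReal_pow hε₁, ← ENNReal.ofReal_pow hε₂,
    show (2 : ENNReal) = ENNReal.ofReal 2 by simp, ← ENNReal.ofReal_mul (by norm_num),
    ← ENNReal.ofReal_mul (by norm_num), ← ENNReal.ofReal_mul (by positivity),
    ← ENNReal.ofReal_add (by positivity) (by positivity)]
  apply ENNReal.ofReal_le_ofReal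
  nlinarith

theorem aux_iso_i {n : ℕ} {ℏ : ℝ} (hℏ : 0 < ℏ) (φ : Ef n → ℝ) (hφ : Continuous φ)
    (hφ1 : ∫⁻ x, ‖φ x‖ₑ ^ 2 = 1) (hφs : ∀ x, φ x ≠ 0 → 0 < x.2) (χ : ℝ → ℝ) (hχ : Continuous χ)
    (G : Ef n → ℂ) (hG : Measurable G) (hG0 : ∀ y : Ef n, y.2 < 0 → G y = 0) :
    ∫⁻ p : Ef n × Ef n, ‖((φ (p.1 - ℏ • p.2) * χ (ℏ • p.2).2 : ℝ) : ℂ) * G (ℏ • p.2)‖ₑ ^ 2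
      ∂((muPlus n).prod volume) =
    ENNReal.ofReal |(ℏ ^ Module.finrank ℝ (Ef n))⁻¹| * ∫⁻ y : Ef n, ‖(χ y.2 : ℂ) * G y‖ₑ ^ 2 := by
  have hm : Measurable (fun y : Ef n => (χ y.2 : ℂ) * G y) :=
    (Complex.measurable_ofReal.comp (hχ.measurable.comp measurable_snd)).mul hG
  rw [← aux_scale volume hℏ.ne' (fun y : Ef n => ‖(χ y.2 : ℂ) * G y‖ₑ ^ 2)
    (hm.enorm.pow_const 2)]
  rw [← aux_iso (muPlus n) volume (fun x v => (φ (x - ℏ • v) : ℂ))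
    (by apply Continuous.measurable; fun_prop) (fun v : Ef n => (χ (ℏ • v).2 : ℂ) * G (ℏ • v))
    (hm.comp (measurable_const_smul ℏ))]
  · congr 1; ext p; congr 2; push_cast; ring
  · refine Eventually.of_forall fun v hv => ?_
    have hv' : 0 ≤ (ℏ • v).2 := by
      by_contra h
      exact hv (by rw [hG0 _ (not_le.1 h), mul_zero])
    rw [aux_lint_muPlus]
    · simp only [enorm_eq_nnnorm, Complex.nnnorm_real] at hφ1 ⊢
      rw [lintegral_sub_right_eq_self (fun x : Ef n => (‖φ x‖₊ : ENNReal) ^ 2)]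
      exact hφ1
    · intro y hy
      have : φ (y - ℏ • v) = 0 := by
        by_contra h
        have := hφs _ h
        rw [Prod.snd_sub] at this
        linarith
      simp [this]

theorem aux_iso_b {n : ℕ} {ℏ : ℝ} (hℏ : 0 < ℏ) (φ : Eb n → ℝ) (hφ : Continuous φ)
    (hφ1 : ∫⁻ x, ‖φ x‖ₑ ^ 2 = 1) (χ : ℝ → ℝ) (hχ : Continuous χ)
    (G : Ef n → ℂ) (hG : Measurable G) (hG0 : ∀ y : Ef n, y.2 < 0 → G y = 0) :
    ∫⁻ p : Eb n × Ef n, ‖((φ (p.1 - (ℏ • p.2).1) * χ (ℏ • p.2).2 : ℝ) : ℂ) * G (ℏ • p.2)‖ₑ ^ 2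
      ∂(muB n) =
    ENNReal.ofReal |(ℏ ^ Module.finrank ℝ (Ef n))⁻¹| * ∫⁻ y : Ef n, ‖(χ y.2 : ℂ) * G y‖ₑ ^ 2 := by
  have hm : Measurable (fun y : Ef n => (χ y.2 : ℂ) * G y) :=
    (Complex.measurable_ofReal.comp (hχ.measurable.comp measurable_snd)).mul hG
  rw [aux_muB_eq, ← aux_scale volume hℏ.ne' (fun y : Ef n => ‖(χ y.2 : ℂ) * G y‖ₑ ^ 2)
    (hm.enorm.pow_const 2)]
  rw [← aux_lint_muPlus (fun y : Ef n => ‖(χ (ℏ • y).2 : ℂ) * G (ℏ • y)‖ₑ ^ 2)]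
  · rw [← aux_iso volume (muPlus n) (fun (x : Eb n) (v : Ef n) => (φ (x - (ℏ • v).1) : ℂ))
      (by apply Continuous.measurable; fun_prop)
      (fun v : Ef n => (χ (ℏ • v).2 : ℂ) * G (ℏ • v)) (hm.comp (measurable_const_smul ℏ))]
    · congr 1; ext p; congr 2; push_cast; ring
    · refine Eventually.of_forall fun v hv => ?_
      simp only [enorm_eq_nnnorm, Complex.nnnorm_real] at hφ1 ⊢
      rw [lintegral_sub_right_eq_self (fun x : Eb n => (‖φ x‖₊ : ENNReal) ^ 2)]
      exact hφ1
  · intro y hy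
    rw [hG0 _ (by simpa using mul_neg_of_pos_of_neg hℏ hy)]
    simp

theorem aux_chi_sum {n : ℕ} (χi χb : ℝ → ℝ) (hi : Continuous χi) (h1 : ∀ t, χi t ^ 2 + χb t ^ 2 = 1)
    (G : Ef n → ℂ) (hG : Measurable G) :
    (∫⁻ y : Ef n, ‖(χi y.2 : ℂ) * G y‖ₑ ^ 2) + (∫⁻ y : Ef n, ‖(χb y.2 : ℂ) * G y‖ₑ ^ 2) =
      ∫⁻ y : Ef n, ‖G y‖ₑ ^ 2 := by
  rw [← lintegral_add_left]
  · congr 1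
    ext y
    rw [enorm_mul, enorm_mul, mul_pow, mul_pow, ← add_mul]
    have : ∀ t : ℝ, ‖(t : ℂ)‖ₑ ^ 2 = ENNReal.ofReal (t ^ 2) := by
      intro t
      rw [← ofReal_norm, Complex.norm_real, ← ENNReal.ofReal_pow (norm_nonneg _), Real.norm_eq_abs,
        sq_abs]
    rw [this, this, ← ENNReal.ofReal_add (sq_nonneg _) (sq_nonneg _), h1, ENNReal.ofReal_one,
      one_mul]
  · exact ((Complex.measurable_ofReal.comp (hi.measurable.comp measurable_snd)).mul
      hG).enorm.pow_const 2

theorem aux_real (a b A B p q M s e c x y : ℝ) (ha : 0 ≤ a) (hb : 0 ≤ b) (hA : 0 ≤ A) (hB : 0 ≤ B)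
    (hp : p ≤ M) (hq : q ≤ M) (hM : 0 ≤ M) (hc : 0 < c) (hx : 0 ≤ x) (he : 0 < e)
    (h1 : A ≤ p * a + s) (h2 : B ≤ q * b + s) (hs : s ≤ e / 2 * (√c * x)) (hs0 : 0 ≤ s)
    (hab : a ^ 2 + b ^ 2 = c * x ^ 2) (hAB : A ^ 2 + B ^ 2 = c * y ^ 2) :
    y ≤ (M + e) * x := by
  set r := √c with hr
  have hr0 : 0 < r := Real.sqrt_pos.2 hc
  have hrc : r ^ 2 = c := Real.sq_sqrt hc.le
  rw [← hrc] at hab hAB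
  set g := r * x with hg
  have hg0 : 0 ≤ g := by positivity
  have hab' : a ^ 2 + b ^ 2 = g ^ 2 := by rw [hab, hg]; ring
  have hag : a ≤ g := by nlinarith
  have hbg : b ≤ g := by nlinarith
  have hA' : A ≤ M * a + e / 2 * g := h1.trans (by gcongr)
  have hB' : B ≤ M * b + e / 2 * g := h2.trans (by gcongr)
  have hA2 : A ^ 2 ≤ (M * a + e / 2 * g) ^ 2 := by gcongr
  have hB2 : B ^ 2 ≤ (M * b + e / 2 * g) ^ 2 := by gcongr
  have hfin : (r * y) ^ 2 ≤ ((M + e) * g) ^ 2 := by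
    have k1 : M * e * g * a ≤ M * e * g * g := by gcongr
    have k2 : M * e * g * b ≤ M * e * g * g := by gcongr
    have k3 : M ^ 2 * (a ^ 2 + b ^ 2) = M ^ 2 * g ^ 2 := by rw [hab']
    nlinarith [mul_nonneg (sq_nonneg e) (sq_nonneg g)]
  have := abs_le_of_sq_le_sq hfin (by positivity)
  have h3 : r * y ≤ r * ((M + e) * x) := by
    calc r * y ≤ (M + e) * g := (le_abs_self _).trans this
      _ = _ := by rw [hg]; ring
  exact le_of_mul_le_mul_left h3 hr0

theorem aux_half_lint {n : ℕ} (ξ : HS n) :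
    ∫⁻ y, ‖({p : Ef n | 0 ≤ p.2}.indicator ξ) y‖ₑ ^ 2 = ENNReal.ofReal (‖ξ‖ ^ 2) := by
  rw [aux_norm_sq, ← aux_lint_muPlus]
  · refine lintegral_congr_ae ?_
    have h : ∀ᵐ y ∂(muPlus n), 0 ≤ y.2 := ae_restrict_mem (aux_half_meas n)
    filter_upwards [h] with y hy
    rw [indicator_of_mem (show y ∈ {p : Ef n | 0 ≤ p.2} from hy)]
  · intro y hy
    rw [indicator_of_notMem (by simpa using hy)]; simp

theorem aux_step {n : ℕ} (f : Ef n × Ef n → ℂ) (K : Eb n × Eb n × ℝ × ℝ → ℂ)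
    (hf : Continuous f) (hK : Continuous K) (R M : ℝ) (hfR : ∀ x w, f (x, w) ≠ 0 → ‖w‖ ≤ R)
    (hKR : ∀ (x' w' : Eb n) s t, K (x', w', s, s - t) ≠ 0 → ‖((w', t) : Ef n)‖ ≤ R)
    (hKs : ∀ (x' w' : Eb n) s t, K (x', w', s, t) ≠ 0 → |s| ≤ R)
    (hfM : ∀ p, ‖f p‖ ≤ M) (hsM : ∀ y s w, ‖symb f K y s w‖ ≤ M)
    (δ ε₁ ε₂ η e : ℝ) (hδ : 0 < δ) (hδ1 : δ ≤ 1) (hε₁ : 0 ≤ ε₁) (hε₂ : 0 ≤ ε₂) (he : 0 < e)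
    (hη : 0 ≤ η)
    (hfu : ∀ x x' w, ‖x - x'‖ ≤ 3 * δ → ‖f (x, w) - f (x', w)‖ ≤ ε₁ / 2)
    (hKu : ∀ (x x' w : Eb n) s t, ‖x - x'‖ ≤ 3 * δ → ‖K (x, w, s, t) - K (x', w, s, t)‖ ≤ ε₁ / 2)
    (φi : Ef n → ℝ) (Ni : ℝ) (hNi : 0 ≤ Ni) (hφil : ∀ x y, |φi x - φi y| ≤ Ni * ‖x - y‖)
    (hφiN : ∀ x, |φi x| ≤ Ni) (hφic : Continuous φi) (hφi1 : ∫⁻ x, ‖φi x‖ₑ ^ 2 = 1)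
    (hφis : ∀ x, φi x ≠ 0 → 0 < x.2 ∧ ‖x‖ ≤ δ)
    (φb : Eb n → ℝ) (Nb : ℝ) (hNb : 0 ≤ Nb) (hφbl : ∀ x y, |φb x - φb y| ≤ Nb * ‖x - y‖)
    (hφbN : ∀ x, |φb x| ≤ Nb) (hφbc : Continuous φb) (hφb1 : ∫⁻ x, ‖φb x‖ₑ ^ 2 = 1)
    (hφbs : ∀ x, φb x ≠ 0 → ‖x‖ ≤ δ)
    (χi χb : ℝ → ℝ) (L : ℝ) (hL : 0 ≤ L) (hχic : Continuous χi) (hχbc : Continuous χb)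
    (hχil : ∀ s t, |χi s - χi t| ≤ L * |s - t|) (hχbl : ∀ s t, |χb s - χb t| ≤ L * |s - t|)
    (hχ1 : ∀ t, χi t ^ 2 + χb t ^ 2 = 1) (hχi0 : ∀ t, t ≤ δ → χi t = 0)
    (hχb0 : ∀ t, 3 * δ ≤ t → χb t = 0)
    (he1 : ε₁ ^ 2 ≤ η / 4)
    (he2i : ε₂ ^ 2 * (volume (Metric.closedBall (0 : Ef n) 2)).toReal ≤ η / 4)
    (he2b : ε₂ ^ 2 * (volume (Metric.closedBall (0 : Eb n) 2)).toReal ≤ η / 4)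
    (hηe : η * (volume (Metric.closedBall (0 : Ef n) R)).toReal ^ 2 ≤ e ^ 2 / 4)
    (ℏ : ℝ) (hℏ : 0 < ℏ) (hℏ1 : ℏ * R ≤ 1) (hℏδ : ℏ * R ≤ δ)
    (hsi : M * (Ni * (L + 1) * (ℏ * R)) ≤ ε₂) (hsb : M * (Nb * (L + 1) * (ℏ * R)) ≤ ε₂)
    (T S : HS n →L[ℂ] HS n) (hT : rhoSpec n ℏ f T) (hS : kappaSpec n ℏ K S)
    (P : HT n →L[ℂ] HT n) (hP : pi0Spec n f P)
    (B : HB n →L[ℂ] HB n) (hB : piBSpec n f K B) (ξ : HS n) :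
    ‖(T + S) ξ‖ ≤ (max ‖P‖ ‖B‖ + e) * ‖ξ‖ := by
  have hχi1 : ∀ t, |χi t| ≤ 1 := by
    intro t; rw [← sq_le_one_iff_abs_le_one]; nlinarith [hχ1 t, sq_nonneg (χb t)]
  have hχb1 : ∀ t, |χb t| ≤ 1 := by
    intro t; rw [← sq_le_one_iff_abs_le_one]; nlinarith [hχ1 t, sq_nonneg (χi t)]
  set c : ℝ := |(ℏ ^ Module.finrank ℝ (Ef n))⁻¹| with hc
  have hc0 : 0 < c := by positivity
  set s : Set (Ef n) := Metric.closedBall (0 : Ef n) R with hs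
  have hsm : MeasurableSet s := Metric.isClosed_closedBall.measurableSet
  have hsfin : volume s ≠ ⊤ := (isCompact_closedBall _ _).measure_ne_top
  set G : Ef n → ℂ := {p : Ef n | 0 ≤ p.2}.indicator ξ with hG
  set H : Ef n → ℂ := {p : Ef n | 0 ≤ p.2}.indicator ((T + S) ξ : HS n) with hH
  have hGm : Measurable G := (Lp.stronglyMeasurable ξ).measurable.indicator (aux_half_meas n)
  have hHm : Measurable H :=
    (Lp.stronglyMeasurable ((T + S) ξ)).measurable.indicator (aux_half_meas n)
  have hG0 : ∀ y : Ef n, y.2 < 0 → G y = 0 := by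
    intro y hy; rw [hG, indicator_of_notMem]; simpa using hy
  have hH0 : ∀ y : Ef n, y.2 < 0 → H y = 0 := by
    intro y hy; rw [hH, indicator_of_notMem]; simpa using hy
  have hGl : ∫⁻ y, ‖G y‖ₑ ^ 2 = ENNReal.ofReal (‖ξ‖ ^ 2) := aux_half_lint ξ
  have hHl : ∫⁻ y, ‖H y‖ₑ ^ 2 = ENNReal.ofReal (‖(T + S) ξ‖ ^ 2) := aux_half_lint _
  have hGf : ∫⁻ y, ‖G y‖ₑ ^ 2 ≠ ⊤ := by rw [hGl]; exact ENNReal.ofReal_ne_top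
  have hHf : ∫⁻ y, ‖H y‖ₑ ^ 2 ≠ ⊤ := by rw [hHl]; exact ENNReal.ofReal_ne_top
  -- the pointwise formula
  have hA : ∀ᵐ v : Ef n, 0 ≤ v.2 →
      H (ℏ • v) = ∫ w, symb f K (ℏ • v) v.2 w * G (ℏ • (v - w)) := by
    have h1 := aux_A hℏ f K hf hK R hfR hKR T S hT hS ξ G hG hGm hGf
    unfold muPlus at h1
    rw [ae_restrict_iff' (aux_half_meas n)] at h1
    have h2 := (Measure.quasiMeasurePreserving_smul (volume : Measure (Ef n)) hℏ.ne').ae h1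
    filter_upwards [h2] with v hv hv0
    have h3 : 0 ≤ (ℏ • v).2 := mul_nonneg hℏ.le hv0
    have h4 : (ℏ • v).2 / ℏ = v.2 := by simp [hℏ.ne']
    rw [hH, indicator_of_mem (by exact h3)]
    refine (hv h3).trans ?_
    rw [h4]
    simp_rw [smul_sub]
  -- support of the symbols
  have hsymb : ∀ y t w, symb f K y t w ≠ 0 → ‖w‖ ≤ R := by
    intro y t w hw
    by_cases h : f (y, w) = 0
    · apply hKR y.1 w.1 t w.2
      simpa [symb, h] using hw
    · exact hfR _ _ h
  have hsc : ∀ y t, Continuous (fun w => symb f K y t w) := by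
    intro y t; unfold symb; fun_prop
  have hmem : ∀ v, MemLp (fun w => G (ℏ • (v - w))) 2 volume :=
    fun v => aux_memLp_comp volume G hGm hGf hℏ.ne' v
  have i1 : ∀ v : Ef n, Integrable (fun w => symb f K (ℏ • v) v.2 w * G (ℏ • (v - w))) :=
    fun v => aux_int volume _ _ R (hsc _ _) (fun w => hsymb _ _ w) (hmem v)
  -- localizing weights
  set ψi : Ef n → Ef n → ℂ := fun x y => ((φi (x - y) * χi y.2 : ℝ) : ℂ) with hψi
  set ψb : Eb n → Ef n → ℂ := fun x y => ((φb (x - y.1) * χb y.2 : ℝ) : ℂ) with hψb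
  have hψic : Continuous (fun p : Ef n × Ef n => ψi p.1 p.2) := by simp only [hψi]; fun_prop
  have hψbc : Continuous (fun p : Eb n × Ef n => ψb p.1 p.2) := by simp only [hψb]; fun_prop
  have hui : ∀ F : Ef n → ℂ, Measurable F → (∀ y : Ef n, y.2 < 0 → F y = 0) →
      ∫⁻ p : Ef n × Ef n, ‖ψi p.1 (ℏ • p.2) * F (ℏ • p.2)‖ₑ ^ 2 ∂(muT n) =
        ENNReal.ofReal c * ∫⁻ y : Ef n, ‖(χi y.2 : ℂ) * F y‖ₑ ^ 2 := fun F hF hF0 =>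
    aux_iso_i hℏ φi hφic hφi1 (fun x hx => (hφis x hx).1) χi hχic F hF hF0
  have hub : ∀ F : Ef n → ℂ, Measurable F → (∀ y : Ef n, y.2 < 0 → F y = 0) →
      ∫⁻ p : Eb n × Ef n, ‖ψb p.1 (ℏ • p.2) * F (ℏ • p.2)‖ₑ ^ 2 ∂(muB n) =
        ENNReal.ofReal c * ∫⁻ y : Ef n, ‖(χb y.2 : ℂ) * F y‖ₑ ^ 2 := fun F hF hF0 =>
    aux_iso_b hℏ φb hφbc hφb1 χb hχbc F hF hF0
  have hle_i : ∀ F : Ef n → ℂ, Measurable F → (∫⁻ y, ‖F y‖ₑ ^ 2 ≠ ⊤) →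
      ∫⁻ y : Ef n, ‖(χi y.2 : ℂ) * F y‖ₑ ^ 2 ≠ ⊤ := by
    intro F hF hFf
    rw [← aux_chi_sum χi χb hχic hχ1 F hF] at hFf
    exact (ENNReal.add_ne_top.1 hFf).1
  have hle_b : ∀ F : Ef n → ℂ, Measurable F → (∫⁻ y, ‖F y‖ₑ ^ 2 ≠ ⊤) →
      ∫⁻ y : Ef n, ‖(χb y.2 : ℂ) * F y‖ₑ ^ 2 ≠ ⊤ := by
    intro F hF hFf
    rw [← aux_chi_sum χi χb hχic hχ1 F hF] at hFf
    exact (ENNReal.add_ne_top.1 hFf).2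
  have hmi : ∀ F : Ef n → ℂ, Measurable F → (∀ y : Ef n, y.2 < 0 → F y = 0) →
      (∫⁻ y, ‖F y‖ₑ ^ 2 ≠ ⊤) →
      MemLp (fun p : Ef n × Ef n => ψi p.1 (ℏ • p.2) * F (ℏ • p.2)) 2 (muT n) := by
    intro F hF hF0 hFf
    apply aux_memLp
    · apply Measurable.aestronglyMeasurable
      exact (hψic.measurable.comp (by fun_prop : Measurable
        (fun p : Ef n × Ef n => (p.1, ℏ • p.2)))).mul (hF.comp (by fun_prop))
    · rw [hui F hF hF0]
      exact ENNReal.mul_ne_top ENNReal.ofReal_ne_top (hle_i F hF hFf)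
  have hmb : ∀ F : Ef n → ℂ, Measurable F → (∀ y : Ef n, y.2 < 0 → F y = 0) →
      (∫⁻ y, ‖F y‖ₑ ^ 2 ≠ ⊤) →
      MemLp (fun p : Eb n × Ef n => ψb p.1 (ℏ • p.2) * F (ℏ • p.2)) 2 (muB n) := by
    intro F hF hF0 hFf
    apply aux_memLp
    · apply Measurable.aestronglyMeasurable
      exact (hψbc.measurable.comp (by fun_prop : Measurable
        (fun p : Eb n × Ef n => (p.1, ℏ • p.2)))).mul (hF.comp (by fun_prop))
    · rw [hub F hF hF0]
      exact ENNReal.mul_ne_top ENNReal.ofReal_ne_top (hle_b F hF hFf)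
  -- sum of squares
  have hsum : ∀ (F : Ef n → ℂ) (hF : Measurable F) (hF0 : ∀ y : Ef n, y.2 < 0 → F y = 0)
      (hFf : ∫⁻ y, ‖F y‖ₑ ^ 2 ≠ ⊤) (q : ℝ) (hq : ∫⁻ y, ‖F y‖ₑ ^ 2 = ENNReal.ofReal (q ^ 2)),
      ‖(hmi F hF hF0 hFf).toLp _‖ ^ 2 + ‖(hmb F hF hF0 hFf).toLp _‖ ^ 2 = c * q ^ 2 := by
    intro F hF hF0 hFf q hq
    have h1 := aux_norm_toLp_sq (hmi F hF hF0 hFf)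
    have h2 := aux_norm_toLp_sq (hmb F hF hF0 hFf)
    rw [hui F hF hF0] at h1
    rw [hub F hF hF0] at h2
    have h3 : ENNReal.ofReal (‖(hmi F hF hF0 hFf).toLp _‖ ^ 2 + ‖(hmb F hF hF0 hFf).toLp _‖ ^ 2)
        = ENNReal.ofReal (c * q ^ 2) := by
      rw [ENNReal.ofReal_add (sq_nonneg _) (sq_nonneg _), h1, h2, ← mul_add,
        aux_chi_sum χi χb hχic hχ1 F hF, hq, ENNReal.ofReal_mul hc0.le]
    exact (ENNReal.ofReal_eq_ofReal_iff (by positivity) (by positivity)).1 h3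
  have hsumG := hsum G hGm hG0 hGf ‖ξ‖ hGl
  have hsumH := hsum H hHm hH0 hHf ‖(T + S) ξ‖ hHl
  set err : ℝ := √((ENNReal.ofReal η * (volume s) ^ 2 *
    (ENNReal.ofReal |(ℏ ^ Module.finrank ℝ (Ef n))⁻¹| * ∫⁻ v, ‖G v‖ₑ ^ 2)).toReal) with herr
  have hzw : ∀ w ∈ s, ‖ℏ • w‖ ≤ ℏ * R := by
    intro w hw
    rw [norm_smul, Real.norm_eq_abs, abs_of_pos hℏ]
    gcongr
    simpa [hs] using hw
  -- interior comparison
  have hI : ‖(hmi H hHm hH0 hHf).toLp _‖ ≤ ‖P‖ * ‖(hmi G hGm hG0 hGf).toLp _‖ + err := by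
    refine aux_core (volume : Measure (Ef n)) (muPlus n) volume le_rfl hℏ.ne' G hGm s hsm
      (muT n) rfl _ _ (hmi G hGm hG0 hGf) (hmi H hHm hH0 hHf) P
      (fun v w => symb f K (ℏ • v) v.2 w) (fun x _ w => f (x, w)) ψi ?_ ?_ i1 ?_
      (fun x v => kker φi ε₁ ε₂ (x - ℏ • v)) ?_ (ENNReal.ofReal η) ENNReal.ofReal_ne_top hsfin hGf
      ?_ ?_
    · exact aux_P f P hP _ (hmi G hGm hG0 hGf)
    · have h2 : ∀ᵐ p ∂(muT n), 0 ≤ p.2.2 → H (ℏ • p.2) =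
          ∫ w, symb f K (ℏ • p.2) p.2.2 w * G (ℏ • (p.2 - w)) :=
        Measure.quasiMeasurePreserving_snd.ae hA
      filter_upwards [h2] with p hp
      by_cases h0 : 0 ≤ p.2.2
      · rw [hp h0]
      · have : χi (ℏ • p.2).2 = 0 := by
          apply hχi0
          have : (ℏ • p.2).2 < 0 := mul_neg_of_pos_of_neg hℏ (not_le.1 h0)
          linarith
        have this2 : ψi p.1 (ℏ • p.2) = 0 := by
          simp only [hψi]; rw [this, mul_zero, Complex.ofReal_zero]
        rw [this2, zero_mul, zero_mul]
    · intro x v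
      have := aux_int volume (fun w => f (x, w) * ψi x (ℏ • (v - w)))
        (fun w => G (ℏ • (v - w))) R (by simp only [hψi]; fun_prop)
        (fun w hw => hfR x w (left_ne_zero_of_mul hw)) (hmem v)
      simpa only [mul_assoc] using this
    · exact (kker_meas φi hφic ε₁ ε₂).comp (by fun_prop)
    · intro v
      refine (lintegral_mono' Measure.restrict_le_self le_rfl).trans ?_
      exact kker_bound' volume φi hφic hφi1 ε₁ ε₂ η hε₁ hε₂ he1 he2i _
    · refine Eventually.of_forall fun p w => ?_
      by_cases hw : w ∈ s
      · rw [indicator_of_mem hw]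
        have hz := hzw w hw
        have hp := aux_pt φi χi Ni L M ε₁ ε₂ (ℏ * R) hL hNi hε₁ hφil hφiN
          (fun x hx => ((hφis x hx).2).trans hδ1) hχil hχi1 (p.1 - ℏ • p.2) (ℏ • w)
          (ℏ • p.2).2 (ℏ • w).2 hz ((norm_snd_le (ℏ • w)).trans hz) hℏ1 hsi
          (symb f K (ℏ • p.2) p.2.2 w) (f (p.1, w)) (hfM _) ?_
        · refine le_trans (le_of_eq ?_) hp
          congr 2
          simp only [hψi, smul_sub, Prod.snd_sub]
          congr 4
          abel
        · intro k1 k2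
          have k3 : δ < (ℏ • p.2).2 := by
            by_contra h; exact k2 (hχi0 _ (not_lt.1 h))
          have k4 : K ((ℏ • p.2).1, w.1, p.2.2, p.2.2 - w.2) = 0 := by
            by_contra h
            have k5 := (le_abs_self _).trans (hKs _ _ _ _ h)
            have k6 : (ℏ • p.2).2 = ℏ * p.2.2 := rfl
            have : ℏ * p.2.2 ≤ ℏ * R := by gcongr
            linarith
          have k7 := hfu (ℏ • p.2) p.1 w (by
            rw [norm_sub_rev]; exact ((hφis _ k1).2).trans (by linarith))
          rw [symb, k4, add_zero]
          linarith
      · rw [indicator_of_notMem hw]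
        have hw' : ¬ ‖w‖ ≤ R := by simpa [hs] using hw
        have k1 : symb f K (ℏ • p.2) p.2.2 w = 0 := by
          by_contra h; exact hw' (hsymb _ _ _ h)
        have k2 : f (p.1, w) = 0 := by
          by_contra h; exact hw' (hfR _ _ h)
        simp [k1, k2]
  -- boundary comparison
  have hBd : ‖(hmb H hHm hH0 hHf).toLp _‖ ≤ ‖B‖ * ‖(hmb G hGm hG0 hGf).toLp _‖ + err := by
    have i2 : ∀ (x : Eb n) (v : Ef n), Integrable (fun w => symb f K (x, 0) v.2 w *
        (ψb x (ℏ • (v - w)) * G (ℏ • (v - w)))) := by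
      intro x v
      have := aux_int volume (fun w => symb f K (x, 0) v.2 w * ψb x (ℏ • (v - w)))
        (fun w => G (ℏ • (v - w))) R (by
          have := hsc (x, 0) v.2
          simp only [hψb]; fun_prop)
        (fun w hw => hsymb _ _ w (left_ne_zero_of_mul hw)) (hmem v)
      simpa only [mul_assoc] using this
    have hpos : ∀ᵐ p ∂(muB n), 0 ≤ p.2.2 :=
      ae_restrict_mem (measurableSet_le (f := fun _ : Eb n × Ef n => (0 : ℝ))
        (g := fun q => q.2.2) measurable_const (by fun_prop))
    refine aux_core (volume : Measure (Ef n)) (volume : Measure (Eb n)) (muPlus n)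
      Measure.restrict_le_self hℏ.ne' G hGm s hsm
      (muB n) (aux_muB_eq n) _ _ (hmb G hGm hG0 hGf) (hmb H hHm hH0 hHf) B
      (fun v w => symb f K (ℏ • v) v.2 w) (fun x v w => symb f K (x, 0) v.2 w) ψb ?_ ?_ i1 i2
      (fun x v => kker φb ε₁ ε₂ (x - (ℏ • v).1)) ?_ (ENNReal.ofReal η) ENNReal.ofReal_ne_top hsfin
      hGf ?_ ?_
    · refine aux_B f K B hB _ (hmb G hGm hG0 hGf) ?_ i2
      intro x v hv
      rw [hG0 _ (mul_neg_of_pos_of_neg hℏ hv), mul_zero]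
    · have hsnd : Measure.QuasiMeasurePreserving (Prod.snd : Eb n × Ef n → Ef n) (muB n)
          (muPlus n) := by
        rw [aux_muB_eq]; exact Measure.quasiMeasurePreserving_snd
      have h2 := hsnd.ae (ae_restrict_of_ae hA)
      filter_upwards [h2, hpos] with p hp h0
      rw [hp h0]
    · exact (kker_meas φb hφbc ε₁ ε₂).comp (by fun_prop)
    · intro v
      exact kker_bound' volume φb hφbc hφb1 ε₁ ε₂ η hε₁ hε₂ he1 he2b _
    · filter_upwards [hpos] with p h0 w
      by_cases hw : w ∈ s
      · rw [indicator_of_mem hw]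
        have hz := hzw w hw
        have hp := aux_pt φb χb Nb L M ε₁ ε₂ (ℏ * R) hL hNb hε₁ hφbl hφbN
          (fun x hx => (hφbs x hx).trans hδ1) hχbl hχb1 (p.1 - (ℏ • p.2).1) (ℏ • w).1
          (ℏ • p.2).2 (ℏ • w).2 ((norm_fst_le (ℏ • w)).trans hz)
          ((norm_snd_le (ℏ • w)).trans hz) hℏ1 hsb
          (symb f K (ℏ • p.2) p.2.2 w) (symb f K (p.1, 0) p.2.2 w) (hsM _ _ _) ?_
        · refine le_trans (le_of_eq ?_) hp
          congr 2
          simp only [hψb, smul_sub, Prod.snd_sub, Prod.fst_sub]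
          congr 4
          abel
        · intro k1 k2
          have k3 : (ℏ • p.2).2 < 3 * δ := by
            by_contra h; exact k2 (hχb0 _ (not_lt.1 h))
          have k4 : 0 ≤ (ℏ • p.2).2 := mul_nonneg hℏ.le h0
          have k5 : ‖(ℏ • p.2).1 - p.1‖ ≤ 3 * δ := by
            rw [norm_sub_rev]; exact (hφbs _ k1).trans (by linarith)
          have k6 := hfu (ℏ • p.2) (p.1, 0) w (by
            rw [Prod.norm_def]
            refine max_le k5 ?_
            rw [Prod.snd_sub, sub_zero, Real.norm_eq_abs, abs_of_nonneg k4]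
            exact k3.le)
          have k7 := hKu (ℏ • p.2).1 p.1 w.1 p.2.2 (p.2.2 - w.2) k5
          unfold symb
          rw [add_sub_add_comm]
          refine (norm_add_le _ _).trans ?_
          linarith
      · rw [indicator_of_notMem hw]
        have hw' : ¬ ‖w‖ ≤ R := by simpa [hs] using hw
        have k1 : ∀ y, symb f K y p.2.2 w = 0 := by
          intro y
          by_contra h; exact hw' (hsymb _ _ _ h)
        simp [k1]
  have herr' : err ≤ e / 2 * (√c * ‖ξ‖) := by
    rw [herr, hGl, ← hc, ENNReal.toReal_mul, ENNReal.toReal_mul, ENNReal.toReal_mul,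
      ENNReal.toReal_pow, ENNReal.toReal_ofReal hη, ENNReal.toReal_ofReal hc0.le,
      ENNReal.toReal_ofReal (sq_nonneg _)]
    apply Real.sqrt_le_iff.2
    refine ⟨by positivity, ?_⟩
    rw [mul_pow, mul_pow, Real.sq_sqrt hc0.le, div_pow]
    norm_num
    have : 0 ≤ c * ‖ξ‖ ^ 2 := by positivity
    exact mul_le_mul_of_nonneg_right hηe this
  exact aux_real _ _ _ _ ‖P‖ ‖B‖ _ err e c ‖ξ‖ ‖(T + S) ξ‖ (norm_nonneg _) (norm_nonneg _)
    (norm_nonneg _) (norm_nonneg _) (le_max_left _ _) (le_max_right _ _)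
    ((norm_nonneg P).trans (le_max_left _ _)) hc0 (norm_nonneg _) he hI hBd herr'
    (Real.sqrt_nonneg _) hsumG hsumH

theorem aux_ev {n : ℕ} (f : Ef n × Ef n → ℂ)
    (hf : Continuous f) (hf' : HasCompactSupport f)
    (K : Eb n × Eb n × ℝ × ℝ → ℂ)
    (hK : Continuous K) (hK' : HasCompactSupport K)
    (T S : ℝ → (HS n →L[ℂ] HS n))
    (hT : ∀ ℏ ∈ Ioc (0:ℝ) 1, rhoSpec n ℏ f (T ℏ))
    (hS : ∀ ℏ ∈ Ioc (0:ℝ) 1, kappaSpec n ℏ K (S ℏ))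
    (P : HT n →L[ℂ] HT n) (hP : pi0Spec n f P)
    (B : HB n →L[ℂ] HB n) (hB : piBSpec n f K B) (e : ℝ) (he : 0 < e) :
    ∀ᶠ ℏ in 𝓝[>] (0:ℝ), ‖T ℏ + S ℏ‖ ≤ max ‖P‖ ‖B‖ + e := by
  obtain ⟨Mf, hMf⟩ := hf'.exists_bound_of_continuous hf
  obtain ⟨MK, hMK⟩ := hK'.exists_bound_of_continuous hK
  obtain ⟨Rf, hRf⟩ := hf'.isCompact.isBounded.exists_norm_le
  obtain ⟨RK, hRK⟩ := hK'.isCompact.isBounded.exists_norm_le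
  have hMf0 : 0 ≤ Mf := (norm_nonneg _).trans (hMf 0)
  have hMK0 : 0 ≤ MK := (norm_nonneg _).trans (hMK 0)
  set R0 : ℝ := max (max Rf RK) 0 with hR0
  have hR00 : 0 ≤ R0 := le_max_right _ _
  have hfR0 : ∀ x w, f (x, w) ≠ 0 → ‖w‖ ≤ R0 := fun x w h =>
    (norm_snd_le (x, w)).trans ((hRf _ (subset_tsupport _ h)).trans
      ((le_max_left _ _).trans (le_max_left _ _)))
  have hKR0 : ∀ (x' w' : Eb n) (s t : ℝ), K (x', w', s, t) ≠ 0 →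
      ‖w'‖ ≤ R0 ∧ |s| ≤ R0 ∧ |t| ≤ R0 := by
    intro x' w' s t h
    have h1 : ‖(x', w', s, t)‖ ≤ R0 :=
      (hRK _ (subset_tsupport _ h)).trans ((le_max_right _ _).trans (le_max_left _ _))
    simp only [Prod.norm_def, max_le_iff, Real.norm_eq_abs] at h1
    exact h1.2
  set R : ℝ := 2 * R0 with hR
  have hRR : R0 ≤ R := by linarith
  set M : ℝ := Mf + MK with hM
  set v : ℝ := (volume (Metric.closedBall (0 : Ef n) R)).toReal with hv
  set q1 : ℝ := (volume (Metric.closedBall (0 : Ef n) 2)).toReal with hq1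
  set q2 : ℝ := (volume (Metric.closedBall (0 : Eb n) 2)).toReal with hq2
  have hv0 : 0 ≤ v := ENNReal.toReal_nonneg
  have hq10 : 0 ≤ q1 := ENNReal.toReal_nonneg
  have hq20 : 0 ≤ q2 := ENNReal.toReal_nonneg
  set η : ℝ := e ^ 2 / 4 / (v ^ 2 + 1) with hη
  have hη0 : 0 < η := by positivity
  have hηe : η * v ^ 2 ≤ e ^ 2 / 4 := by
    rw [hη, div_mul_eq_mul_div, div_le_iff₀ (by positivity)]
    nlinarith [sq_nonneg e]
  set ε₁ : ℝ := √η / 2 with hε₁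
  have hε₁0 : 0 < ε₁ := by positivity
  have he1 : ε₁ ^ 2 ≤ η / 4 := by
    rw [hε₁, div_pow, Real.sq_sqrt hη0.le]; norm_num
  set ε₂ : ℝ := √(η / (4 * (q1 + q2 + 1))) with hε₂
  have hε₂0 : 0 < ε₂ := by positivity
  have hε₂s : ε₂ ^ 2 * (q1 + q2 + 1) = η / 4 := by
    rw [hε₂, Real.sq_sqrt (by positivity)]; field_simp
  have he2i : ε₂ ^ 2 * q1 ≤ η / 4 := by
    rw [← hε₂s]; gcongr; linarith
  have he2b : ε₂ ^ 2 * q2 ≤ η / 4 := by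
    rw [← hε₂s]; gcongr; linarith
  obtain ⟨δf, hδf, hδf'⟩ := Metric.uniformContinuous_iff.1
    (hf'.uniformContinuous_of_continuous hf) (ε₁ / 2) (by positivity)
  obtain ⟨δK, hδK, hδK'⟩ := Metric.uniformContinuous_iff.1
    (hK'.uniformContinuous_of_continuous hK) (ε₁ / 2) (by positivity)
  set δ : ℝ := min (min δf δK) 1 / 4 with hδ
  have hδ0 : 0 < δ := by positivity
  have hδ1 : δ ≤ 1 := by
    have := min_le_right (min δf δK) 1
    linarith
  have hδ3f : 3 * δ < δf := by
    have := (min_le_left (min δf δK) 1).trans (min_le_left _ _)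
    linarith
  have hδ3K : 3 * δ < δK := by
    have := (min_le_left (min δf δK) 1).trans (min_le_right _ _)
    linarith
  obtain ⟨φi, Ni, hNi, hφil, hφiN, hφic, hφis, hφi1⟩ :=
    aux_bump (volume : Measure (Ef n)) ((0, δ / 2) : Ef n) (δ / 2) (by positivity)
  obtain ⟨φb, Nb, hNb, hφbl, hφbN, hφbc, hφbs, hφb1⟩ :=
    aux_bump (volume : Measure (Eb n)) (0 : Eb n) δ hδ0
  obtain ⟨χi, χb, L, hL, hχic, hχbc, hχil, hχbl, hχ1, hχi0, hχb0⟩ := aux_cut δ hδ0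
  have ev : ∀ (a b : ℝ), 0 < b → ∀ᶠ ℏ in 𝓝[>] (0:ℝ), a * ℏ ≤ b := by
    intro a b hb
    have h1 : Tendsto (fun ℏ : ℝ => a * ℏ) (𝓝[>] 0) (𝓝 (a * 0)) :=
      ((continuous_const.mul continuous_id).tendsto 0).mono_left nhdsWithin_le_nhds
    rw [mul_zero] at h1
    exact (h1.eventually (gt_mem_nhds hb)).mono fun _ h => le_of_lt h
  filter_upwards [Ioc_mem_nhdsGT (zero_lt_one' ℝ), ev R 1 one_pos, ev R δ hδ0,
    ev (M * (Ni * (L + 1) * R)) ε₂ hε₂0, ev (M * (Nb * (L + 1) * R)) ε₂ hε₂0]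
    with ℏ hℏ h1 h2 h3 h4
  refine ContinuousLinearMap.opNorm_le_bound _ ?_ fun ξ => ?_
  · have := (norm_nonneg P).trans (le_max_left ‖P‖ ‖B‖)
    linarith
  refine aux_step f K hf hK R M (fun x w h => (hfR0 x w h).trans hRR) ?_
    (fun x w s t h => (hKR0 x w s t h).2.1.trans hRR)
    (fun p => (hMf p).trans (by linarith))
    (fun y s w => (norm_add_le _ _).trans (add_le_add (hMf _) (hMK _)))
    δ ε₁ ε₂ η e hδ0 hδ1 hε₁0.le hε₂0.le he hη0.le ?_ ?_
    φi Ni hNi hφil hφiN hφic hφi1 ?_ φb Nb hNb hφbl hφbN hφbc hφb1 ?_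
    χi χb L hL hχic hχbc hχil hχbl hχ1 hχi0 hχb0 he1 he2i he2b hηe
    ℏ hℏ.1 (by linarith) (by linarith) (by linarith) (by linarith) (T ℏ) (S ℏ)
    (hT ℏ hℏ) (hS ℏ hℏ) P hP B hB ξ
  · intro x' w' s t h
    obtain ⟨a1, a2, a3⟩ := hKR0 _ _ _ _ h
    rw [Prod.norm_def]
    refine max_le (a1.trans hRR) ?_
    rw [Real.norm_eq_abs]
    rw [abs_le] at a2 a3 ⊢
    constructor <;> linarith
  · intro x x' w h
    rw [← dist_eq_norm]
    refine le_of_lt (hδf' ?_)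
    rw [Prod.dist_eq, dist_self, dist_eq_norm]
    exact max_lt (h.trans_lt hδ3f) hδf
  · intro x x' w s t h
    rw [← dist_eq_norm]
    refine le_of_lt (hδK' ?_)
    rw [Prod.dist_eq, dist_self, dist_eq_norm]
    exact max_lt (h.trans_lt hδ3K) hδK
  · intro x hx
    have h5 := hφis x hx
    rw [Prod.norm_def, max_lt_iff, Prod.fst_sub, Prod.snd_sub, sub_zero, Real.norm_eq_abs,
      abs_lt] at h5
    obtain ⟨b1, b2, b3⟩ := h5
    simp only at b1 b2 b3
    refine ⟨by linarith, ?_⟩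
    rw [Prod.norm_def]
    refine max_le (by linarith) ?_
    rw [Real.norm_eq_abs, abs_le]
    constructor <;> linarith
  · intro x hx
    have := hφbs x hx
    rw [sub_zero] at this
    exact this.le

/-- For every `f ∈ C_c^∞(ℝⁿ×ℝⁿ)` and every smooth compactly supported `K` on
`ℝ^{n−1}×ℝ^{n−1}×ℝ₊×ℝ₊`, `limsup_{ℏ→0⁺} ‖ρ_ℏ(f)+κ_ℏ(K)‖ ≤ max{‖π₀(f)‖, ‖π₀^∂(f⊕K)‖}`:
the field `ℏ ↦ ρ_ℏ(f)+κ_ℏ(K)` is upper semi-continuous in norm at `ℏ=0`. -/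
theorem statement14 (n : ℕ) (hn : 1 ≤ n) (f : Ef n × Ef n → ℂ)
    (hf : ContDiff ℝ ∞ f) (hf' : HasCompactSupport f)
    (K : Eb n × Eb n × ℝ × ℝ → ℂ)
    (hK : ContDiff ℝ ∞ K) (hK' : HasCompactSupport K)
    (T S : ℝ → (HS n →L[ℂ] HS n))
    (hT : ∀ ℏ ∈ Ioc (0:ℝ) 1, rhoSpec n ℏ f (T ℏ))
    (hS : ∀ ℏ ∈ Ioc (0:ℝ) 1, kappaSpec n ℏ K (S ℏ))
    (P : HT n →L[ℂ] HT n) (hP : pi0Spec n f P)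
    (B : HB n →L[ℂ] HB n) (hB : piBSpec n f K B) :
    Filter.limsup (fun ℏ => ‖T ℏ + S ℏ‖) (𝓝[>] (0:ℝ)) ≤ max ‖P‖ ‖B‖ := by
  refine le_of_forall_pos_le_add fun e he => ?_
  refine limsup_le_of_le (isCoboundedUnder_le_of_le (x := 0) _ fun ℏ => norm_nonneg _) ?_
  exact aux_ev f hf.continuous hf' K hK.continuous hK' T S hT hS P hP B hB e he
end
end

section
/- For every f ∈ C_c^∞(ℝⁿ×ℝⁿ), the half-space half-convolution operator π₀^∂(f⊕0) is bounded on L²(ℝ^{n−1}×ℝ^{n−1}×ℝ₊) with operator norm exactly equal to sup{ |f̂(x',0,ξ)| : x'∈ℝ^{n−1}, ξ∈ℝⁿ }, the supremum of the absolute value of the fiberwise Fourier transform of f over the boundary. -/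
open MeasureTheory Filter Topology Set
open scoped ContDiff

noncomputable section

/-- Fourier transform of `f` in the second (fiber) variable:
`f̂(x,ξ) = ∫_{ℝⁿ} e^{−i⟨w,ξ⟩} f(x,w) dw`. -/
def fhatE (n : ℕ) (f : Ef n × Ef n → ℂ) : Ef n × Ef n → ℂ :=
  fun p => ∫ w : Ef n,
    Complex.exp (-(Complex.I) * Complex.ofReal ((∑ i, w.1 i * p.2.1 i) + w.2 * p.2.2)) *
      f (p.1, w)

open scoped SchwartzMap FourierTransform ENNReal
open SchwartzMap

lemma core_schwartz {E : Type*} [NormedAddCommGroup E] [InnerProductSpace ℝ E]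
    [FiniteDimensional ℝ E] [MeasurableSpace E] [BorelSpace E]
    (g u : 𝓢(E, ℂ)) (M : ℝ) (hM : ∀ ξ, ‖𝓕 (g : E → ℂ) ξ‖ ≤ M) :
    eLpNorm (fun v => ∫ w, u w * g (v - w)) 2 volume ≤ ENNReal.ofReal M * eLpNorm u 2 volume := by
  set c := SchwartzMap.convolution (ContinuousLinearMap.mul ℂ ℂ) u g with hc
  have h1 : (fun v => ∫ w, u w * g (v - w)) = c := by
    ext v
    rw [hc, SchwartzMap.convolution_apply]
    rfl
  have pl : ∀ s : 𝓢(E, ℂ), eLpNorm s 2 volume = eLpNorm (𝓕 s : 𝓢(E, ℂ)) 2 volume := by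
    intro s
    have := SchwartzMap.norm_fourier_toL2_eq s
    rw [SchwartzMap.norm_toLp, SchwartzMap.norm_toLp] at this
    have h1 : eLpNorm (𝓕 s : 𝓢(E, ℂ)) 2 volume ≠ ⊤ :=
      (SchwartzMap.memLp (𝓕 s : 𝓢(E, ℂ)) 2 volume).2.ne
    have h2 : eLpNorm s 2 volume ≠ ⊤ := (SchwartzMap.memLp s 2 volume).2.ne
    exact ((ENNReal.toReal_eq_toReal_iff' h1 h2).1 this).symm
  rw [h1, pl, pl u]
  have := eLpNorm_le_mul_eLpNorm_of_ae_le_mul (f := (𝓕 c : 𝓢(E, ℂ))) (g := (𝓕 u : 𝓢(E, ℂ))) (c := M) (μ := volume)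
    (Eventually.of_forall fun ξ => ?_) 2
  · exact this
  · rw [hc, SchwartzMap.fourier_convolution]
    simp only [pairing_apply_apply, ContinuousLinearMap.mul_apply', norm_mul]
    rw [mul_comm]
    gcongr
    exact hM ξ

lemma core_L2 {E : Type*} [NormedAddCommGroup E] [InnerProductSpace ℝ E]
    [FiniteDimensional ℝ E] [MeasurableSpace E] [BorelSpace E]
    (g : E → ℂ) (hg : ContDiff ℝ ∞ g) (hg' : HasCompactSupport g)
    (u : E → ℂ) (hu : MemLp u 2 volume) (M : ℝ) (hM : ∀ ξ, ‖𝓕 g ξ‖ ≤ M) :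
    eLpNorm (fun v => ∫ w, u w * g (v - w)) 2 volume ≤ ENNReal.ofReal M * eLpNorm u 2 volume := by
  have hM0 : 0 ≤ M := (norm_nonneg _).trans (hM 0)
  have happ : ∀ k : ℕ, ∃ s, HasCompactSupport s ∧ ContDiff ℝ ∞ s ∧
      eLpNorm (u - s) 2 volume ≤ ENNReal.ofReal (1 / ((k:ℝ) + 1)) := fun k =>
    hu.exist_eLpNorm_sub_le (by simp) (by norm_num) (by positivity)
  choose s hs1 hs2 hs3 using happ
  have hsm : ∀ k, MemLp (s k) 2 volume := fun k =>
    (hs2 k).continuous.memLp_of_hasCompactSupport (hs1 k)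
  have hgm : MemLp g 2 volume := hg.continuous.memLp_of_hasCompactSupport hg'
  have hgv : ∀ v, MemLp (fun w => g (v - w)) 2 volume := fun v =>
    hgm.comp_measurePreserving (Measure.measurePreserving_sub_left volume v)
  have h0 : Tendsto (fun k : ℕ => ENNReal.ofReal (1 / ((k:ℝ) + 1))) atTop (𝓝 0) := by
    rw [← ENNReal.ofReal_zero]
    exact ENNReal.tendsto_ofReal tendsto_one_div_add_atTop_nhds_zero_nat
  have h0' : Tendsto (fun k : ℕ => eLpNorm (u - s k) 2 volume) atTop (𝓝 0) :=
    tendsto_of_tendsto_of_tendsto_of_le_of_le tendsto_const_nhds h0 (fun _ => zero_le) hs3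
  have hint : ∀ (a : E → ℂ), MemLp a 2 volume → ∀ v, Integrable (fun w => a w * g (v - w)) :=
    fun a ha v => ha.integrable_mul (hgv v)
  have hlim : ∀ v, Tendsto (fun k => ∫ w, s k w * g (v - w)) atTop (𝓝 (∫ w, u w * g (v - w))) := by
    intro v
    rw [tendsto_iff_edist_tendsto_0]
    have hb : ∀ k, edist (∫ w, s k w * g (v - w)) (∫ w, u w * g (v - w)) ≤
        eLpNorm (u - s k) 2 volume * eLpNorm (fun w => g (v - w)) 2 volume := by
      intro k
      rw [edist_comm, edist_eq_enorm_sub, ← integral_sub (hint _ hu v) (hint _ (hsm k) v)]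
      refine (enorm_integral_le_lintegral_enorm _).trans ?_
      have := eLpNorm_smul_le_mul_eLpNorm (μ := volume) (p := 2) (q := 2) (r := 1)
        (hgv v).1 (hu.sub (hsm k)).1
      refine le_trans (le_of_eq ?_) this
      rw [eLpNorm_one_eq_lintegral_enorm]
      refine lintegral_congr fun w => ?_
      simp [sub_mul]
    have hz : Tendsto (fun k => eLpNorm (u - s k) 2 volume *
        eLpNorm (fun w => g (v - w)) 2 volume) atTop (𝓝 0) := by
      have := ENNReal.Tendsto.mul_const (b := eLpNorm (fun w => g (v - w)) 2 volume) h0'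
        (Or.inr (hgv v).2.ne)
      simpa using this
    exact tendsto_of_tendsto_of_tendsto_of_le_of_le tendsto_const_nhds hz (fun _ => zero_le) hb
  have hk : ∀ k, eLpNorm (fun v => ∫ w, s k w * g (v - w)) 2 volume ≤
      ENNReal.ofReal M * (eLpNorm u 2 volume + ENNReal.ofReal (1 / ((k:ℝ) + 1))) := by
    intro k
    refine (core_schwartz (hg'.toSchwartzMap hg) ((hs1 k).toSchwartzMap (hs2 k)) M hM).trans ?_
    gcongr
    have : (s k) = u - (u - s k) := by simp
    calc eLpNorm (s k) 2 volume = eLpNorm (u - (u - s k)) 2 volume := by rw [← this]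
      _ ≤ _ := eLpNorm_sub_le hu.1 (hu.sub (hsm k)).1 (by norm_num)
      _ ≤ _ := by gcongr; exact hs3 k
  have hsmeas : ∀ k, AEStronglyMeasurable (fun v => ∫ w, s k w * g (v - w)) volume := by
    intro k
    have hc : Continuous (fun p : E × E => s k p.2 * g (p.1 - p.2)) := by
      have := (hs2 k).continuous
      have := hg.continuous
      fun_prop
    exact (hc.stronglyMeasurable.integral_prod_right' (ν := volume)).aestronglyMeasurable
  refine (Lp.eLpNorm_lim_le_liminf_eLpNorm hsmeas _ (Eventually.of_forall hlim)).trans ?_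
  have hT : Tendsto (fun k : ℕ => ENNReal.ofReal M * (eLpNorm u 2 volume +
      ENNReal.ofReal (1 / ((k:ℝ) + 1)))) atTop (𝓝 (ENNReal.ofReal M * (eLpNorm u 2 volume + 0))) :=
    ENNReal.Tendsto.const_mul (tendsto_const_nhds.add h0) (Or.inr (by simp))
  refine (liminf_le_liminf (Eventually.of_forall hk)).trans ?_
  rw [hT.liminf_eq]; simp

lemma core_F (m : ℕ) (g : (Fin m → ℝ) × ℝ → ℂ) (hg : ContDiff ℝ ∞ g) (hg' : HasCompactSupport g)
    (u : (Fin m → ℝ) × ℝ → ℂ) (hu : MemLp u 2 volume) (M : ℝ)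
    (hM : ∀ η : (Fin m → ℝ) × ℝ, ‖∫ w : (Fin m → ℝ) × ℝ,
      Complex.exp (-(Complex.I) * Complex.ofReal ((∑ i, w.1 i * η.1 i) + w.2 * η.2)) * g w‖ ≤ M) :
    eLpNorm (fun v => ∫ w, u w * g (v - w)) 2 volume ≤ ENNReal.ofReal M * eLpNorm u 2 volume := by
  let φ : WithLp 2 (EuclideanSpace ℝ (Fin m) × ℝ) ≃L[ℝ] (Fin m → ℝ) × ℝ :=
    (WithLp.prodContinuousLinearEquiv 2 ℝ _ _).trans
      ((EuclideanSpace.equiv (Fin m) ℝ).prodCongr (ContinuousLinearEquiv.refl ℝ ℝ))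
  have hφ : MeasurePreserving φ volume volume :=
    ((PiLp.volume_preserving_ofLp (Fin m)).prod (MeasurePreserving.id volume)).comp
      (WithLp.volume_preserving_ofLp (EuclideanSpace ℝ (Fin m)) ℝ)
  have hemb : MeasurableEmbedding φ := φ.toHomeomorph.measurableEmbedding
  have key := core_L2 (g ∘ φ) (hg.comp φ.contDiff)
    (hg'.comp_homeomorph φ.toHomeomorph) (u ∘ φ) (hu.comp_measurePreserving hφ) M ?_
  · rw [eLpNorm_comp_measurePreserving hu.1 hφ] at key
    rw [← hφ.map_eq, hemb.eLpNorm_map_measure, hφ.map_eq]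
    refine le_trans (le_of_eq ?_) key
    congr 1
    ext v
    simp only [Function.comp]
    rw [← hφ.integral_comp hemb]
    simp
  · intro ξ
    rw [Real.fourier_eq']
    refine le_trans (le_of_eq ?_) (hM ((2 * Real.pi) • φ ξ))
    rw [← hφ.integral_comp hemb]
    congr 1
    refine integral_congr_ae (Eventually.of_forall fun v => ?_)
    simp only [Function.comp, smul_eq_mul]
    congr 2
    have : inner ℝ v ξ = (∑ i, (φ v).1 i * (φ ξ).1 i) + (φ v).2 * (φ ξ).2 := by
      simp [φ, WithLp.prod_inner_apply, PiLp.inner_apply, mul_comm]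
    rw [this]
    push_cast
    simp only [Prod.smul_fst, Prod.smul_snd, Pi.smul_apply, smul_eq_mul]
    push_cast
    have hs : (∑ i, ((φ v).1 i : ℂ) * (2 * (Real.pi : ℂ) * ((φ ξ).1 i : ℂ))) =
        2 * (Real.pi : ℂ) * ∑ i, ((φ v).1 i : ℂ) * ((φ ξ).1 i : ℂ) := by
      rw [Finset.mul_sum]
      exact Finset.sum_congr rfl fun i _ => by ring
    rw [hs]
    ring

/-- Lebesgue measure on the open half-space, as a product. -/
def nuH (n : ℕ) : Measure (Ef n) := (volume : Measure (Eb n)).prod (volume.restrict (Ioi (0:ℝ)))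

instance (n : ℕ) : SFinite (nuH n) := by unfold nuH; infer_instance

lemma nuH_eq (n : ℕ) : nuH n = volume.restrict {w : Ef n | 0 < w.2} := by
  have h : {w : Ef n | 0 < w.2} = univ ×ˢ Ioi (0:ℝ) := by ext; simp
  rw [h, nuH, Measure.volume_eq_prod, ← Measure.prod_restrict, Measure.restrict_univ]

lemma muB_eq (n : ℕ) : muB n = (volume : Measure (Eb n)).prod (nuH n) := by
  have h : {q : Eb n × Eb n × ℝ | 0 ≤ q.2.2} = univ ×ˢ (univ ×ˢ Ici (0:ℝ)) := by ext; simp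
  rw [muB, h, nuH, Measure.volume_eq_prod, ← Measure.prod_restrict, Measure.restrict_univ,
    Measure.volume_eq_prod, ← Measure.prod_restrict, Measure.restrict_univ,
    Measure.restrict_congr_set Ioi_ae_eq_Ici]

lemma eLpNorm_sq {α : Type*} [MeasurableSpace α] (μ : Measure α) (h : α → ℂ) :
    eLpNorm h 2 μ ^ 2 = ∫⁻ a, ‖h a‖ₑ ^ 2 ∂μ := by
  have := eLpNorm_nnreal_pow_eq_lintegral (f := h) (μ := μ) (p := 2) (by norm_num)
  simpa using this

/-- The half-convolution applied to a function. -/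
def psi (n : ℕ) (f : Ef n × Ef n → ℂ) (h : Eb n × Eb n × ℝ → ℂ) : Eb n × Eb n × ℝ → ℂ :=
  fun q => ∫ w' : Eb n, ∫ wn in Ioi (0:ℝ),
      (f ((q.1, (0:ℝ)), (q.2.1 - w', q.2.2 - wn)) + 0) * (h (q.1, w', wn))

section

instance haarProd (m : ℕ) : (volume : Measure ((Fin m → ℝ) × ℝ)).IsAddHaarMeasure := by
  rw [Measure.volume_eq_prod]
  infer_instance

instance negInv (m : ℕ) : (volume : Measure ((Fin m → ℝ) × ℝ)).IsNegInvariant :=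
  Measure.IsAddHaarMeasure.isNegInvariant_of_regular _

variable {n : ℕ} {f : Ef n × Ef n → ℂ}

lemma slice_contDiff (hf : ContDiff ℝ ∞ f) (x : Eb n) :
    ContDiff ℝ ∞ (fun w : Ef n => f ((x, (0:ℝ)), w)) :=
  hf.comp (contDiff_const.prodMk contDiff_id)

lemma slice_cs (hf' : HasCompactSupport f) (x : Eb n) :
    HasCompactSupport (fun w : Ef n => f ((x, (0:ℝ)), w)) := by
  refine HasCompactSupport.intro (IsCompact.image hf' continuous_snd) fun w hw => ?_
  by_contra h
  exact hw ⟨_, subset_tsupport f h, rfl⟩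

lemma slice_memLp (hf : ContDiff ℝ ∞ f) (hf' : HasCompactSupport f) (x : Eb n) (v : Ef n) :
    MemLp (fun w : Ef n => f ((x, (0:ℝ)), v - w)) 2 (nuH n) := by
  have h1 : MemLp (fun w : Ef n => f ((x, (0:ℝ)), w)) 2 volume :=
    (slice_contDiff hf x).continuous.memLp_of_hasCompactSupport (slice_cs hf' x)
  have h2 := h1.comp_measurePreserving (Measure.measurePreserving_sub_left volume v)
  rw [nuH_eq]
  exact h2.restrict _

lemma psi_eq_of_memLp (hf : ContDiff ℝ ∞ f) (hf' : HasCompactSupport f) (x : Eb n)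
    (h : Eb n × Eb n × ℝ → ℂ) (hh : MemLp (fun w => h (x, w)) 2 (nuH n)) (v : Ef n) :
    psi n f h (x, v) = ∫ w, f ((x, (0:ℝ)), v - w) * h (x, w) ∂(nuH n) := by
  have hi : Integrable (fun w => f ((x, (0:ℝ)), v - w) * h (x, w)) (nuH n) :=
    (slice_memLp hf hf' x v).integrable_mul hh
  unfold nuH at hi ⊢
  rw [integral_prod _ hi]
  simp only [psi, add_zero]
  rfl

lemma ae_slice_memLp (h : Eb n × Eb n × ℝ → ℂ) (hh : MemLp h 2 (muB n)) :
    ∀ᵐ x : Eb n, MemLp (fun w => h (x, w)) 2 (nuH n) := by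
  rw [muB_eq] at hh
  have h1 := hh.1.prodMk_left
  have h2 : ∫⁻ q, ‖h q‖ₑ ^ 2 ∂((volume : Measure (Eb n)).prod (nuH n)) ≠ ⊤ := by
    rw [← eLpNorm_sq]
    exact ENNReal.pow_ne_top hh.2.ne
  have hm : AEMeasurable (fun q => ‖h q‖ₑ ^ 2) ((volume : Measure (Eb n)).prod (nuH n)) :=
    hh.1.enorm.pow_const 2
  rw [lintegral_prod _ hm] at h2
  have h3 := ae_lt_top' hm.lintegral_prod_right' h2
  filter_upwards [h1, h3] with x hx1 hx3
  refine ⟨hx1, ?_⟩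
  rw [← eLpNorm_sq] at hx3
  exact lt_top_iff_ne_top.2 fun hc => by simp [hc] at hx3

lemma ae_slice_eq {h h' : Eb n × Eb n × ℝ → ℂ} (e : h =ᵐ[muB n] h') :
    ∀ᵐ x : Eb n, (fun w => h (x, w)) =ᵐ[nuH n] fun w => h' (x, w) := by
  rw [muB_eq] at e
  exact Measure.ae_ae_of_ae_prod e

lemma ae_lift {P : Eb n → Prop} (hP : ∀ᵐ x, P x) : ∀ᵐ q ∂(muB n), P q.1 := by
  rw [muB_eq]
  exact Measure.quasiMeasurePreserving_fst.ae hP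

lemma psi_aesm (hf : ContDiff ℝ ∞ f) (h : Eb n × Eb n × ℝ → ℂ) (hh : StronglyMeasurable h) :
    StronglyMeasurable (psi n f h) := by
  have hc := hf.continuous
  have h1 : StronglyMeasurable (fun p : ((Eb n × Eb n × ℝ) × Eb n) × ℝ =>
      (f ((p.1.1.1, (0:ℝ)), (p.1.1.2.1 - p.1.2, p.1.1.2.2 - p.2)) + 0) *
        h (p.1.1.1, p.1.2, p.2)) := by
    refine StronglyMeasurable.mul ?_ ?_
    · refine Continuous.stronglyMeasurable ?_
      fun_prop
    · exact hh.comp_measurable (by fun_prop)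
  have h2 := h1.integral_prod_right' (ν := volume.restrict (Ioi (0:ℝ)))
  exact h2.integral_prod_right' (ν := (volume : Measure (Eb n)))

/-- Fiberwise estimate. -/
lemma psi_slice_le (hf : ContDiff ℝ ∞ f) (hf' : HasCompactSupport f) (M : ℝ)
    (hM : ∀ p : Eb n × Ef n, ‖fhatE n f ((p.1, (0:ℝ)), p.2)‖ ≤ M) (x : Eb n)
    (h : Eb n × Eb n × ℝ → ℂ) (hh : MemLp (fun w => h (x, w)) 2 (nuH n)) :
    eLpNorm (fun v => psi n f h (x, v)) 2 (nuH n) ≤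
      ENNReal.ofReal M * eLpNorm (fun w => h (x, w)) 2 (nuH n) := by
  have hS : MeasurableSet {w : Ef n | 0 < w.2} := measurableSet_lt measurable_const measurable_snd
  have hmem : MemLp ({w : Ef n | 0 < w.2}.indicator (fun w => h (x, w))) 2 volume := by
    rw [memLp_indicator_iff_restrict hS, ← nuH_eq]; exact hh
  have key := core_F (n - 1) (fun w => f ((x, (0:ℝ)), w)) (slice_contDiff hf x) (slice_cs hf' x)
    _ hmem M (fun η => hM (x, η))
  rw [eLpNorm_indicator_eq_eLpNorm_restrict hS, ← nuH_eq] at key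
  refine le_trans ?_ key
  have e : (fun v => psi n f h (x, v)) = fun v => ∫ w : Ef n,
      {w : Ef n | 0 < w.2}.indicator (fun w => h (x, w)) w * f ((x, (0:ℝ)), v - w) := by
    ext v
    rw [psi_eq_of_memLp hf hf' x h hh v, nuH_eq, ← integral_indicator hS]
    congr 1
    ext w
    by_cases hw : w ∈ {w : Ef n | 0 < w.2} <;> simp [hw, mul_comm]
  rw [e]
  nth_rewrite 1 [nuH_eq]
  exact eLpNorm_restrict_le _ _ _ _

lemma psi_le (hf : ContDiff ℝ ∞ f) (hf' : HasCompactSupport f) (M : ℝ)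
    (hM : ∀ p : Eb n × Ef n, ‖fhatE n f ((p.1, (0:ℝ)), p.2)‖ ≤ M)
    (h : Eb n × Eb n × ℝ → ℂ) (hh : MemLp h 2 (muB n)) (hsm : StronglyMeasurable h) :
    eLpNorm (psi n f h) 2 (muB n) ≤ ENNReal.ofReal M * eLpNorm h 2 (muB n) := by
  have h1 : eLpNorm (psi n f h) 2 (muB n) ^ 2 ≤
      (ENNReal.ofReal M * eLpNorm h 2 (muB n)) ^ 2 := by
    rw [mul_pow, eLpNorm_sq, eLpNorm_sq]
    have hsl := ae_slice_memLp h hh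
    rw [muB_eq]
    rw [lintegral_prod _ ((psi_aesm hf h hsm).enorm.pow_const 2).aemeasurable,
      lintegral_prod _ (hsm.enorm.pow_const 2).aemeasurable,
      ← lintegral_const_mul' _ _ (by simp)]
    refine lintegral_mono_ae ?_
    filter_upwards [hsl] with x hx
    have := psi_slice_le hf hf' M hM x h hx
    rw [← eLpNorm_sq, ← eLpNorm_sq, ← mul_pow]
    gcongr
  exact (ENNReal.pow_le_pow_left_iff (by norm_num)).1 h1

lemma psi_memLp (hf : ContDiff ℝ ∞ f) (hf' : HasCompactSupport f) (M : ℝ)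
    (hM : ∀ p : Eb n × Ef n, ‖fhatE n f ((p.1, (0:ℝ)), p.2)‖ ≤ M) (ξ : HB n) :
    MemLp (psi n f ξ) 2 (muB n) :=
  ⟨(psi_aesm hf _ (Lp.stronglyMeasurable ξ)).aestronglyMeasurable,
    (psi_le hf hf' M hM _ (Lp.memLp ξ) (Lp.stronglyMeasurable ξ)).trans_lt
      (ENNReal.mul_lt_top (by simp) (Lp.memLp ξ).2)⟩

lemma exists_B (hf : ContDiff ℝ ∞ f) (hf' : HasCompactSupport f) (M : ℝ)
    (hM : ∀ p : Eb n × Ef n, ‖fhatE n f ((p.1, (0:ℝ)), p.2)‖ ≤ M) :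
    ∃ B : HB n →L[ℂ] HB n, piBSpec n f (fun _ => 0) B := by
  have hM0 : 0 ≤ M := (norm_nonneg _).trans (hM 0)
  let L : HB n →ₗ[ℂ] HB n :=
    { toFun := fun ξ => (psi_memLp hf hf' M hM ξ).toLp
      map_add' := by
        intro ξ η
        rw [← MemLp.toLp_add]
        refine MemLp.toLp_congr _ _ ?_
        filter_upwards [ae_lift (ae_slice_memLp _ (Lp.memLp ξ)),
          ae_lift (ae_slice_memLp _ (Lp.memLp η)), ae_lift (ae_slice_memLp _ (Lp.memLp (ξ + η))),
          ae_lift (ae_slice_eq (Lp.coeFn_add ξ η))] with q h1 h2 h3 h4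
        obtain ⟨x, v⟩ := q
        simp only [Pi.add_apply]
        have i1 : Integrable (fun w => f ((x, (0:ℝ)), v - w) * ξ (x, w)) (nuH n) :=
          (slice_memLp hf hf' x v).integrable_mul h1
        have i2 : Integrable (fun w => f ((x, (0:ℝ)), v - w) * η (x, w)) (nuH n) :=
          (slice_memLp hf hf' x v).integrable_mul h2
        rw [psi_eq_of_memLp hf hf' x _ h1 v, psi_eq_of_memLp hf hf' x _ h2 v,
          psi_eq_of_memLp hf hf' x _ h3 v, ← integral_add i1 i2]
        refine integral_congr_ae ?_
        filter_upwards [h4] with w hw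
        rw [hw]
        simp [mul_add]
      map_smul' := by
        intro c ξ
        rw [RingHom.id_apply, ← MemLp.toLp_const_smul]
        refine MemLp.toLp_congr _ _ ?_
        filter_upwards [ae_lift (ae_slice_memLp _ (Lp.memLp ξ)),
          ae_lift (ae_slice_memLp _ (Lp.memLp (c • ξ))),
          ae_lift (ae_slice_eq (Lp.coeFn_smul c ξ))] with q h1 h3 h4
        obtain ⟨x, v⟩ := q
        simp only [Pi.smul_apply, smul_eq_mul]
        rw [psi_eq_of_memLp hf hf' x _ h1 v,
          psi_eq_of_memLp hf hf' x _ h3 v, ← integral_const_mul]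
        refine integral_congr_ae ?_
        filter_upwards [h4] with w hw
        rw [hw]
        simp only [Pi.smul_apply, smul_eq_mul]
        ring }
  refine ⟨L.mkContinuous M fun ξ => ?_, fun ξ => ?_⟩
  · show ‖(psi_memLp hf hf' M hM ξ).toLp‖ ≤ _
    rw [Lp.norm_toLp, Lp.norm_def]
    have := ENNReal.toReal_mono (ENNReal.mul_ne_top (by simp) (Lp.memLp ξ).2.ne)
      (psi_le hf hf' M hM _ (Lp.memLp ξ) (Lp.stronglyMeasurable ξ))
    rwa [ENNReal.toReal_mul, ENNReal.toReal_ofReal hM0] at this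
  · exact (psi_memLp hf hf' M hM ξ).coeFn_toLp

lemma norm_le_M (hf : ContDiff ℝ ∞ f) (hf' : HasCompactSupport f) (M : ℝ)
    (hM : ∀ p : Eb n × Ef n, ‖fhatE n f ((p.1, (0:ℝ)), p.2)‖ ≤ M)
    (B : HB n →L[ℂ] HB n) (hB : piBSpec n f (fun _ => 0) B) : ‖B‖ ≤ M := by
  have hM0 : 0 ≤ M := (norm_nonneg _).trans (hM 0)
  refine B.opNorm_le_bound hM0 fun ξ => ?_
  have e : ⇑(B ξ) =ᵐ[muB n] psi n f ξ := hB ξ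
  rw [Lp.norm_def, Lp.norm_def, eLpNorm_congr_ae e]
  have := ENNReal.toReal_mono (ENNReal.mul_ne_top (by simp) (Lp.memLp ξ).2.ne)
    (psi_le hf hf' M hM _ (Lp.memLp ξ) (Lp.stronglyMeasurable ξ))
  rwa [ENNReal.toReal_mul, ENNReal.toReal_ofReal hM0] at this

lemma bdd_fhat (hf : ContDiff ℝ ∞ f) (hf' : HasCompactSupport f) :
    BddAbove (range fun p : Eb n × Ef n => ‖fhatE n f ((p.1, (0:ℝ)), p.2)‖) := by
  obtain ⟨C, hC⟩ := hf'.exists_bound_of_continuous hf.continuous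
  have hK : IsCompact (Prod.snd '' tsupport f) := IsCompact.image hf' continuous_snd
  refine ⟨C * volume.real (Prod.snd '' tsupport f), ?_⟩
  rintro _ ⟨p, rfl⟩
  simp only [fhatE]
  rw [← setIntegral_eq_integral_of_forall_compl_eq_zero (s := Prod.snd '' tsupport f)]
  · refine norm_setIntegral_le_of_norm_le_const hK.measure_lt_top fun w _ => ?_
    rw [norm_mul, Complex.norm_exp]
    simpa using hC _
  · intro w hw
    rw [mul_eq_zero]; right
    by_contra h
    exact hw ⟨_, subset_tsupport f h, rfl⟩

lemma cont_fhat (hf : ContDiff ℝ ∞ f) (hf' : HasCompactSupport f) (η : Ef n) :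
    Continuous fun x : Eb n => fhatE n f ((x, (0:ℝ)), η) := by
  have hK : IsCompact (Prod.snd '' tsupport f) := IsCompact.image hf' continuous_snd
  have hc := hf.continuous
  have : (fun x : Eb n => fhatE n f ((x, (0:ℝ)), η)) = fun x => ∫ w in Prod.snd '' tsupport f,
      Complex.exp (-(Complex.I) * Complex.ofReal ((∑ i, w.1 i * η.1 i) + w.2 * η.2)) *
      f ((x, (0:ℝ)), w) := by
    ext x
    rw [setIntegral_eq_integral_of_forall_compl_eq_zero]
    · rfl
    · intro w hw
      rw [mul_eq_zero]; right
      by_contra h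
      exact hw ⟨_, subset_tsupport f h, rfl⟩
  rw [this]
  refine continuous_parametric_integral_of_continuous ?_ hK
  fun_prop
end

section

variable {n : ℕ} {f : Ef n × Ef n → ℂ}

/-- The plane wave `e^{i⟨w,η⟩}`. -/
def wave (n : ℕ) (η w : Ef n) : ℂ :=
  Complex.exp (Complex.I * Complex.ofReal ((∑ i, w.1 i * η.1 i) + w.2 * η.2))

lemma wave_cont (η : Ef n) : Continuous (wave n η) := by
  unfold wave; fun_prop

lemma wave_norm (η w : Ef n) : ‖wave n η w‖ = 1 := by
  unfold wave
  rw [mul_comm]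
  exact Complex.norm_exp_ofReal_mul_I _

lemma wave_conv (x : Eb n) (η v : Ef n) :
    ∫ w : Ef n, f ((x, (0:ℝ)), v - w) * wave n η w = wave n η v * fhatE n f ((x, (0:ℝ)), η) := by
  rw [← integral_sub_left_eq_self _ volume v]
  simp only [fhatE, sub_sub_cancel]
  rw [← integral_const_mul]
  refine integral_congr_ae (Eventually.of_forall fun w => ?_)
  simp only [wave]
  rw [← mul_assoc, ← Complex.exp_add, mul_comm]
  congr 2
  simp only [Prod.fst_sub, Prod.snd_sub, Pi.sub_apply, sub_mul, Finset.sum_sub_distrib]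
  push_cast
  ring

/-- The half-space box. -/
def box (n : ℕ) (R s : ℝ) : Set (Ef n) := Metric.closedBall ((0, R) : Ef n) s

lemma box_meas (R s : ℝ) : MeasurableSet (box n R s) := Metric.isClosed_closedBall.measurableSet

lemma box_vol (R s : ℝ) (hs : 0 ≤ s) : volume (box n R s) =
    ENNReal.ofReal (s ^ Module.finrank ℝ (Ef n)) * volume (Metric.closedBall (0 : Ef n) 1) :=
  Measure.addHaar_closedBall' _ _ hs

lemma lower_ineq (hf : ContDiff ℝ ∞ f) (hf' : HasCompactSupport f)
    (B : HB n →L[ℂ] HB n) (hB : piBSpec n f (fun _ => 0) B) (η : Ef n) (A : Set (Eb n))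
    (hA : MeasurableSet A) (hA' : volume A ≠ ⊤) (hA0 : volume A ≠ 0) (c : ℝ) (hc0 : 0 ≤ c)
    (hc : ∀ x ∈ A, c ≤ ‖fhatE n f ((x, (0:ℝ)), η)‖) (r : ℝ) (hr : 0 < r)
    (hsupp : ∀ (x : Eb n) (w : Ef n), f ((x, (0:ℝ)), w) ≠ 0 → ‖w‖ < r) (R : ℝ) (hR : r < R) :
    c ^ 2 * (R - r) ^ Module.finrank ℝ (Ef n) ≤ ‖B‖ ^ 2 * R ^ Module.finrank ℝ (Ef n) := by
  set h : Eb n × Eb n × ℝ → ℂ := (A ×ˢ box n R R).indicator (fun q => wave n η q.2) with hh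
  have hmS : MeasurableSet (A ×ˢ box n R R) := hA.prod (box_meas R R)
  have hsm : StronglyMeasurable h :=
    (((wave_cont η).comp continuous_snd).stronglyMeasurable).indicator hmS
  have hfin : volume (box n R R) ≠ ⊤ := (isCompact_closedBall _ _).measure_ne_top
  have hnorm : eLpNorm h 2 (muB n) ^ 2 ≤ volume A * volume (box n R R) := by
    rw [eLpNorm_sq]
    have e : (fun q => ‖h q‖ₑ ^ 2) = (A ×ˢ box n R R).indicator (1 : Eb n × Eb n × ℝ → ℝ≥0∞) := by
      ext q
      by_cases hq : q ∈ A ×ˢ box n R R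
      · simp only [hh, indicator_of_mem hq]
        rw [← ofReal_norm, wave_norm]; simp
      · simp [hh, indicator_of_notMem hq]
    rw [e, lintegral_indicator_one hmS, muB_eq, Measure.prod_prod]
    gcongr
    rw [nuH_eq]
    exact Measure.restrict_le_self
  have hmem : MemLp h 2 (muB n) := by
    refine ⟨hsm.aestronglyMeasurable, lt_top_iff_ne_top.2 fun hcon => ?_⟩
    rw [hcon] at hnorm
    exact absurd (top_le_iff.1 (by simpa using hnorm)) (ENNReal.mul_ne_top hA' hfin)
  set ξ : HB n := hmem.toLp with hξ
  have e1 : ⇑(B ξ) =ᵐ[muB n] psi n f ξ := hB ξ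
  -- pointwise value on the inner box
  have hval : ∀ᵐ q ∂(muB n), q ∈ A ×ˢ box n R (R - r) →
      ENNReal.ofReal c ≤ ‖(B ξ) q‖ₑ := by
    filter_upwards [e1, ae_lift (ae_slice_memLp _ (Lp.memLp ξ)),
      ae_lift (ae_slice_eq hmem.coeFn_toLp)] with q h1 h2 h3 hq
    obtain ⟨x, v⟩ := q
    obtain ⟨hx, hv⟩ := hq
    simp only at hx hv h2 h3
    have hvd : ‖v - ((0, R) : Ef n)‖ ≤ R - r := by
      rw [← dist_eq_norm]; exact hv
    have hp : psi n f ξ (x, v) = wave n η v * fhatE n f ((x, (0:ℝ)), η) := by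
      rw [psi_eq_of_memLp hf hf' x _ h2 v, ← wave_conv, nuH_eq]
      rw [← setIntegral_eq_integral_of_forall_compl_eq_zero (s := {w : Ef n | 0 < w.2})
        (f := fun w => f ((x, (0:ℝ)), v - w) * wave n η w)]
      · refine integral_congr_ae ?_
        rw [← nuH_eq]
        filter_upwards [h3] with w hw
        rw [hw]
        by_cases hz : f ((x, (0:ℝ)), v - w) = 0
        · simp [hz]
        · have hlt := hsupp x _ hz
          have hwb : w ∈ box n R R := by
            rw [box, Metric.mem_closedBall, dist_eq_norm]
            have : w - ((0, R) : Ef n) = (v - ((0, R) : Ef n)) - (v - w) := by abel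
            rw [this]
            refine (norm_sub_le _ _).trans ?_
            linarith
          have : (x, w) ∈ A ×ˢ box n R R := ⟨hx, hwb⟩
          rw [hh, indicator_of_mem this]
      · intro w hw
        rw [mul_eq_zero]; left
        by_contra hz
        have hlt := hsupp x _ hz
        apply hw
        have a1 : |v.2 - w.2| < r := lt_of_le_of_lt (norm_snd_le (v - w)) hlt
        have a2 : |v.2 - R| ≤ R - r := (norm_snd_le (v - ((0, R) : Ef n))).trans hvd
        rw [abs_lt] at a1
        rw [abs_le] at a2
        show 0 < w.2
        linarith
    rw [h1, hp, ← ofReal_norm, norm_mul, wave_norm, one_mul]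
    exact ENNReal.ofReal_le_ofReal (hc x hx)
  have hmS' : MeasurableSet (A ×ˢ box n R (R - r)) := hA.prod (box_meas _ _)
  have hlow : ENNReal.ofReal c ^ 2 * (volume A * volume (box n R (R - r))) ≤
      eLpNorm (B ξ) 2 (muB n) ^ 2 := by
    rw [eLpNorm_sq]
    have e2 : volume A * volume (box n R (R - r)) = muB n (A ×ˢ box n R (R - r)) := by
      rw [muB_eq, Measure.prod_prod, nuH_eq, Measure.restrict_apply (box_meas _ _)]
      congr 2
      symm
      rw [inter_eq_left]
      intro v hv
      have hvd : ‖v - ((0, R) : Ef n)‖ ≤ R - r := by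
        rw [← dist_eq_norm]; exact hv
      have a2 : |v.2 - R| ≤ R - r := (norm_snd_le (v - ((0, R) : Ef n))).trans hvd
      rw [abs_le] at a2
      show 0 < v.2
      linarith
    rw [e2, ← setLIntegral_const]
    refine le_trans ?_ (setLIntegral_le_lintegral (A ×ˢ box n R (R - r)) _)
    refine lintegral_mono_ae ?_
    rw [ae_restrict_iff' hmS']
    filter_upwards [hval] with q hq hq'
    exact pow_le_pow_left' (hq hq') 2
  have hup : eLpNorm (B ξ) 2 (muB n) ≤ ENNReal.ofReal ‖B‖ * eLpNorm h 2 (muB n) := by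
    have := B.le_opNorm ξ
    rw [Lp.norm_def, hξ, Lp.norm_toLp] at this
    rw [← ENNReal.ofReal_toReal (Lp.memLp (B ξ)).2.ne, ← ENNReal.ofReal_toReal hmem.2.ne,
      ← ENNReal.ofReal_mul (norm_nonneg _)]
    exact ENNReal.ofReal_le_ofReal this
  have hfinal : ENNReal.ofReal c ^ 2 * (volume A * volume (box n R (R - r))) ≤
      ENNReal.ofReal ‖B‖ ^ 2 * (volume A * volume (box n R R)) := by
    refine hlow.trans ((pow_le_pow_left' hup 2).trans ?_)
    rw [mul_pow]
    gcongr
  rw [box_vol _ _ (by linarith), box_vol _ _ (by linarith)] at hfinal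
  set V := volume (Metric.closedBall (0 : Ef n) 1)
  have hV0 : V ≠ 0 := (Metric.measure_closedBall_pos volume _ one_pos).ne'
  have hV1 : V ≠ ⊤ := (isCompact_closedBall _ _).measure_ne_top
  have hfin2 := ENNReal.toReal_mono (by finiteness) hfinal
  simp only [ENNReal.toReal_mul, ENNReal.toReal_pow, ENNReal.toReal_ofReal hc0,
    ENNReal.toReal_ofReal (norm_nonneg B),
    ENNReal.toReal_ofReal (pow_nonneg (by linarith : 0 ≤ R - r) _),
    ENNReal.toReal_ofReal (pow_nonneg (by linarith : 0 ≤ R) _)] at hfin2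
  have hAp : 0 < (volume A).toReal := ENNReal.toReal_pos hA0 hA'
  have hVp : 0 < V.toReal := ENNReal.toReal_pos hV0 hV1
  refine le_of_mul_le_mul_right ?_ (mul_pos hAp hVp)
  calc _ = c ^ 2 * ((volume A).toReal * ((R - r) ^ Module.finrank ℝ (Ef n) * V.toReal)) := by ring
    _ ≤ _ := hfin2
    _ = _ := by ring

lemma lower (hf : ContDiff ℝ ∞ f) (hf' : HasCompactSupport f)
    (B : HB n →L[ℂ] HB n) (hB : piBSpec n f (fun _ => 0) B) (x₀ : Eb n) (η : Ef n) :
    ‖fhatE n f ((x₀, (0:ℝ)), η)‖ ≤ ‖B‖ := by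
  by_contra! hlt
  obtain ⟨c, hc1, hc2⟩ := exists_between hlt
  have hc0 : 0 ≤ c := (norm_nonneg B).trans hc1.le
  have hev : ∀ᶠ x in 𝓝 x₀, c < ‖fhatE n f ((x, (0:ℝ)), η)‖ :=
    (cont_fhat hf hf' η).norm.continuousAt.eventually (lt_mem_nhds hc2)
  obtain ⟨δ, hδ, hball⟩ := Metric.eventually_nhds_iff_ball.1 hev
  have hK : IsCompact (Prod.snd '' tsupport f) := IsCompact.image hf' continuous_snd
  obtain ⟨r, hr, hKr⟩ := hK.isBounded.subset_ball_lt 0 0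
  have hsupp : ∀ (x : Eb n) (w : Ef n), f ((x, (0:ℝ)), w) ≠ 0 → ‖w‖ < r := by
    intro x w hw
    have : w ∈ Metric.ball (0 : Ef n) r := hKr ⟨_, subset_tsupport f hw, rfl⟩
    simpa using this
  have key : ∀ R, r < R → c ^ 2 * (1 - r / R) ^ Module.finrank ℝ (Ef n) ≤ ‖B‖ ^ 2 := by
    intro R hR
    have hRp : 0 < R := hr.trans hR
    have := lower_ineq hf hf' B hB η (Metric.ball x₀ δ) Metric.isOpen_ball.measurableSet
      Metric.isBounded_ball.measure_lt_top.ne (Metric.measure_ball_pos volume _ hδ).ne' c hc0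
      (fun x hx => (hball x hx).le) r hr hsupp R hR
    have e : 1 - r / R = (R - r) / R := by field_simp
    rw [e, div_pow, ← mul_div_assoc, div_le_iff₀ (by positivity)]
    exact this
  have hlim : Tendsto (fun R : ℝ => c ^ 2 * (1 - r / R) ^ Module.finrank ℝ (Ef n)) atTop
      (𝓝 (c ^ 2 * (1 - 0) ^ Module.finrank ℝ (Ef n))) :=
    ((tendsto_const_nhds.sub (tendsto_const_nhds.div_atTop tendsto_id)).pow _).const_mul _
  have := le_of_tendsto hlim ((eventually_gt_atTop r).mono key)
  simp only [sub_zero, one_pow, mul_one] at this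
  exact absurd (pow_le_pow_iff_left₀ hc0 (norm_nonneg B) (by norm_num) |>.1 this) (not_le.2 hc1)

end

/-- For every `f ∈ C_c^∞(ℝⁿ×ℝⁿ)`, the half-space half-convolution operator `π₀^∂(f⊕0)`
is bounded on `L²(ℝ^{n−1}×ℝ^{n−1}×ℝ₊)` with operator norm exactly
`sup{ |f̂(x',0,ξ)| : x' ∈ ℝ^{n−1}, ξ ∈ ℝⁿ }`. -/
theorem statement15 (n : ℕ) (hn : 1 ≤ n) (f : Ef n × Ef n → ℂ)
    (hf : ContDiff ℝ ∞ f) (hf' : HasCompactSupport f) :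
    (∃ B : HB n →L[ℂ] HB n, piBSpec n f (fun _ => 0) B) ∧
    (∀ B : HB n →L[ℂ] HB n, piBSpec n f (fun _ => 0) B →
      ‖B‖ = ⨆ p : Eb n × Ef n, ‖fhatE n f ((p.1, (0:ℝ)), p.2)‖) := by
  have hbdd := bdd_fhat hf hf'
  have hM : ∀ p : Eb n × Ef n, ‖fhatE n f ((p.1, (0:ℝ)), p.2)‖ ≤
      ⨆ p : Eb n × Ef n, ‖fhatE n f ((p.1, (0:ℝ)), p.2)‖ := fun p => le_ciSup hbdd p
  refine ⟨exists_B hf hf' _ hM, fun B hB => le_antisymm (norm_le_M hf hf' _ hM B hB) ?_⟩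
  exact ciSup_le fun p => lower hf hf' B hB p.1 p.2
end
end

section
/- For every f ∈ C_c^∞(ℝⁿ×ℝⁿ), one has ‖π₀^∂(f⊕0)‖ ≤ ‖π₀(f)‖; i.e., the norm of the boundary half-convolution operator is bounded by the norm of the full fiberwise convolution operator. -/
open MeasureTheory Filter Topology Set
open scoped ContDiff

noncomputable section

instance instHaarEf (n : ℕ) : (volume : Measure (Ef n)).IsAddHaarMeasure := by
  rw [Measure.volume_eq_prod]; infer_instance

lemma lintegral_muT (n : ℕ) (F : Ef n × Ef n → ENNReal) (hF : Measurable F) :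
    ∫⁻ p, F p ∂(muT n) =
      ∫⁻ t in Ici (0:ℝ), ∫⁻ q : Eb n × Ef n, F ((q.1, t), q.2) := by
  have h1 : muPlus n = (volume : Measure (Eb n)).prod ((volume : Measure ℝ).restrict (Ici 0)) := by
    have h2 : {p : Ef n | 0 ≤ p.2} = univ ×ˢ Ici (0:ℝ) := by ext p; simp
    rw [muPlus, h2, Measure.volume_eq_prod, ← Measure.prod_restrict, Measure.restrict_univ]
  rw [muT, lintegral_prod _ hF.aemeasurable, h1,
    lintegral_prod_symm _ hF.lintegral_prod_right'.aemeasurable]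
  refine lintegral_congr fun t => ?_
  rw [Measure.volume_eq_prod (Eb n) (Ef n), lintegral_prod]
  exact (hF.comp (by fun_prop)).aemeasurable

lemma eLpNorm_two_sq {α : Type*} [MeasurableSpace α] (μ : Measure α) (u : α → ℂ) :
    eLpNorm u 2 μ ^ 2 = ∫⁻ x, ‖u x‖ₑ ^ 2 ∂μ := by
  have := eLpNorm_nnreal_pow_eq_lintegral (f := u) (μ := μ) (p := 2) (by norm_num)
  simpa using! this

/-- the fibrewise convolution at height `t` -/
def Hc (n : ℕ) (f : Ef n × Ef n → ℂ) (u : Eb n × Ef n → ℂ) (t : ℝ) (q : Eb n × Ef n) : ℂ :=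
  ∫ w : Ef n, f ((q.1, t), q.2 - w) * u (q.1, w)

lemma Hc_meas (n : ℕ) (f : Ef n × Ef n → ℂ) (hf : Continuous f) (u : Eb n × Ef n → ℂ)
    (hu : Measurable u) : Measurable (fun z : ℝ × (Eb n × Ef n) => Hc n f u z.1 z.2) := by
  have : StronglyMeasurable (fun y : (ℝ × (Eb n × Ef n)) × Ef n =>
      f ((y.1.2.1, y.1.1), y.1.2.2 - y.2) * u (y.1.2.1, y.2)) := by
    apply Measurable.stronglyMeasurable
    exact (hf.measurable.comp (by fun_prop)).mul (hu.comp (by fun_prop))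
  exact this.integral_prod_right'.measurable

lemma stepA (n : ℕ) (f : Ef n × Ef n → ℂ) (hf : Continuous f)
    (P : HT n →L[ℂ] HT n) (hP : pi0Spec n f P)
    (u : Eb n × Ef n → ℂ) (hu : Measurable u) (hu2 : ∫⁻ q, ‖u q‖ₑ ^ 2 ≠ ⊤) (ε : ℝ) (hε : 0 < ε) :
    ∫⁻ t in Ioo 0 ε, ∫⁻ q, ‖Hc n f u t q‖ₑ ^ 2
      ≤ ‖P‖ₑ ^ 2 * (ENNReal.ofReal ε * ∫⁻ q, ‖u q‖ₑ ^ 2) := by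
  set η : Ef n × Ef n → ℂ := fun p => (Ioo (0:ℝ) ε).indicator (fun _ => u (p.1.1, p.2)) p.1.2
    with hη
  have hηm : Measurable η := by
    have : η = ({p : Ef n × Ef n | p.1.2 ∈ Ioo (0:ℝ) ε}).indicator (fun p => u (p.1.1, p.2)) := by
      ext p; simp [hη, indicator]
    rw [this]
    apply Measurable.indicator
    · exact hu.comp (by fun_prop)
    · exact measurableSet_Ioo.preimage (by fun_prop : Measurable fun p : Ef n × Ef n => p.1.2)
  have key : ∀ G : ℝ → ENNReal,
      ∫⁻ t in Ici (0:ℝ), (Ioo (0:ℝ) ε).indicator G t = ∫⁻ t in Ioo 0 ε, G t := by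
    intro G
    rw [lintegral_indicator measurableSet_Ioo, Measure.restrict_restrict measurableSet_Ioo,
      inter_eq_left.2]
    exact fun t ht => ht.1.le
  have hηn : ∫⁻ p, ‖η p‖ₑ ^ 2 ∂(muT n) = ENNReal.ofReal ε * ∫⁻ q, ‖u q‖ₑ ^ 2 := by
    rw [lintegral_muT n _ (by fun_prop)]
    have : ∀ t : ℝ, ∫⁻ q : Eb n × Ef n, ‖η ((q.1, t), q.2)‖ₑ ^ 2 =
        (Ioo (0:ℝ) ε).indicator (fun _ => ∫⁻ q, ‖u q‖ₑ ^ 2) t := by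
      intro t
      by_cases ht : t ∈ Ioo (0:ℝ) ε <;> simp only [hη, indicator, ht] <;> simp
    simp_rw [this]
    rw [key]
    simp [mul_comm]
  have hηL : MemLp η 2 (muT n) := by
    refine ⟨hηm.aestronglyMeasurable, ?_⟩
    have h1 := eLpNorm_two_sq (muT n) η
    rw [hηn] at h1
    have h2 : eLpNorm η 2 (muT n) ^ 2 ≠ ⊤ := by
      rw [h1]; exact ENNReal.mul_ne_top ENNReal.ofReal_ne_top hu2
    rw [lt_top_iff_ne_top]
    intro h; simp [h] at h2
  set ξ : HT n := hηL.toLp η with hξ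
  have hPξ : ⇑(P ξ) =ᵐ[muT n] fun p => (Ioo (0:ℝ) ε).indicator
      (fun t => Hc n f u t (p.1.1, p.2)) p.1.2 := by
    have h1 := hηL.coeFn_toLp
    have h2 : ∀ᵐ p ∂(muT n), ∀ᵐ v : Ef n, ξ (p.1, v) = η (p.1, v) :=
      Measure.quasiMeasurePreserving_fst.ae (Measure.ae_ae_of_ae_prod h1)
    filter_upwards [hP ξ, h2] with p hp1 hp2
    rw [hp1]
    have h3 : ∀ᵐ w : Ef n, ξ (p.1, p.2 - w) = η (p.1, p.2 - w) :=
      (quasiMeasurePreserving_sub_left_of_right_invariant volume p.2).ae hp2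
    rw [integral_congr_ae (g := fun w => f (p.1, w) * η (p.1, p.2 - w))
      (h3.mono fun w hw => by simp only [hw])]
    by_cases ht : p.1.2 ∈ Ioo (0:ℝ) ε
    · simp only [hη, indicator, ht, if_true, Hc]
      rw [← integral_sub_left_eq_self _ volume p.2]
      simp
    · simp only [hη, indicator, ht, if_false]
      simp
  have e1 : ∫⁻ p, ‖(P ξ) p‖ₑ ^ 2 ∂(muT n) = ∫⁻ t in Ioo 0 ε, ∫⁻ q, ‖Hc n f u t q‖ₑ ^ 2 := by
    rw [lintegral_congr_ae (hPξ.mono fun p hp => by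
      change _ = ‖(Ioo (0:ℝ) ε).indicator
        (fun t => Hc n f u t (p.1.1, p.2)) p.1.2‖ₑ ^ 2
      simp only [hp]), lintegral_muT]
    · rw [← key]
      refine lintegral_congr fun t => ?_
      by_cases ht : t ∈ Ioo (0:ℝ) ε <;> simp only [indicator, ht] <;> simp
    · have hH := Hc_meas n f hf u hu
      have : (fun p : Ef n × Ef n => (Ioo (0:ℝ) ε).indicator
          (fun t => Hc n f u t (p.1.1, p.2)) p.1.2) =
          ({p : Ef n × Ef n | p.1.2 ∈ Ioo (0:ℝ) ε}).indicator
            (fun p => Hc n f u p.1.2 (p.1.1, p.2)) := by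
        ext p; simp [indicator]
      have h5 : Measurable (fun p : Ef n × Ef n => (Ioo (0:ℝ) ε).indicator
          (fun t => Hc n f u t (p.1.1, p.2)) p.1.2) := by
        rw [this]
        apply Measurable.indicator
        · exact hH.comp (g := fun z : ℝ × (Eb n × Ef n) => Hc n f u z.1 z.2)
            (f := fun p : Ef n × Ef n => (p.1.2, (p.1.1, p.2))) (by fun_prop)
        · exact measurableSet_Ioo.preimage
            (by fun_prop : Measurable fun p : Ef n × Ef n => p.1.2)
      exact h5.enorm.pow_const 2
  rw [← e1, ← eLpNorm_two_sq, ← hηn, ← eLpNorm_two_sq, ← mul_pow,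
    ← eLpNorm_congr_ae hηL.coeFn_toLp, ← Lp.enorm_def, ← Lp.enorm_def]
  gcongr
  exact ContinuousLinearMap.le_opENorm P ξ

lemma stepB (n : ℕ) (f : Ef n × Ef n → ℂ) (hf : Continuous f) (hf' : HasCompactSupport f)
    (u : Eb n × Ef n → ℂ) (hu : Measurable u) (hu2 : ∫⁻ q, ‖u q‖ₑ ^ 2 ≠ ⊤) :
    ∀ᵐ q : Eb n × Ef n, ∃ b : Ef n → ℝ, Integrable b ∧
      ∀ t w, ‖f ((q.1, t), q.2 - w) * u (q.1, w)‖ ≤ b w := by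
  obtain ⟨M, hM⟩ := hf'.exists_bound_of_continuous hf
  have hK : IsCompact (Prod.snd '' tsupport f) := hf'.isCompact.image continuous_snd
  set K := Prod.snd '' tsupport f with hKdef
  have h1 : ∀ᵐ x : Eb n, ∫⁻ w : Ef n, ‖u (x, w)‖ₑ ^ 2 < ⊤ := by
    apply ae_lt_top
    · exact Measurable.lintegral_prod_right' (f := fun q : Eb n × Ef n => ‖u q‖ₑ ^ 2) (by fun_prop)
    · rwa [Measure.volume_eq_prod, lintegral_prod _ (by fun_prop)] at hu2
  have h2 : ∀ᵐ q : Eb n × Ef n, ∫⁻ w : Ef n, ‖u (q.1, w)‖ₑ ^ 2 < ⊤ :=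
    Measure.quasiMeasurePreserving_fst.ae h1
  filter_upwards [h2] with q hq
  have hL : MemLp (fun w => u (q.1, w)) 2 volume := by
    refine ⟨(hu.comp (by fun_prop)).aestronglyMeasurable, ?_⟩
    rw [← eLpNorm_two_sq (volume) (fun w => u (q.1, w))] at hq
    rw [lt_top_iff_ne_top]
    intro h; simp [h] at hq
  set K' : Set (Ef n) := (fun w => q.2 - w) ⁻¹' K
  have hK' : IsCompact K' := (Homeomorph.subLeft q.2).isCompact_preimage.2 hK
  have hI : MemLp (K'.indicator (fun _ : Ef n => M)) 2 volume :=
    memLp_indicator_const 2 hK'.measurableSet M (Or.inr hK'.measure_lt_top.ne)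
  refine ⟨fun w => K'.indicator (fun _ : Ef n => M) w * ‖u (q.1, w)‖,
    hI.integrable_mul hL.norm, fun t w => ?_⟩
  rw [norm_mul]
  refine mul_le_mul_of_nonneg_right ?_ (norm_nonneg _)
  by_cases hw : w ∈ K'
  · rw [indicator_of_mem hw]; exact hM _
  · rw [indicator_of_notMem hw]
    have : ((q.1, t), q.2 - w) ∉ tsupport f := fun h => hw ⟨_, h, rfl⟩
    simp [image_eq_zero_of_notMem_tsupport this]

lemma stepC (n : ℕ) (f : Ef n × Ef n → ℂ) (hf : Continuous f) (hf' : HasCompactSupport f)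
    (P : HT n →L[ℂ] HT n) (hP : pi0Spec n f P)
    (u : Eb n × Ef n → ℂ) (hu : Measurable u) (hu2 : ∫⁻ q, ‖u q‖ₑ ^ 2 ≠ ⊤) :
    ∫⁻ q, ‖Hc n f u 0 q‖ₑ ^ 2 ≤ ‖P‖ₑ ^ 2 * ∫⁻ q, ‖u q‖ₑ ^ 2 := by
  have hH := Hc_meas n f hf u hu
  have hHt : ∀ t, Measurable (fun q => Hc n f u t q) := fun t =>
    hH.comp (measurable_prodMk_left (x := t))
  have hGm : Measurable (fun t => ∫⁻ q, ‖Hc n f u t q‖ₑ ^ 2) :=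
    Measurable.lintegral_prod_right' (f := fun z : ℝ × (Eb n × Ef n) => ‖Hc n f u z.1 z.2‖ₑ ^ 2)
      (hH.enorm.pow_const 2)
  have h1 : ∀ k : ℕ, ∃ t ∈ Ioo (0:ℝ) (1 / ((k:ℝ) + 1)),
      ∫⁻ q, ‖Hc n f u t q‖ₑ ^ 2 ≤ ‖P‖ₑ ^ 2 * ∫⁻ q, ‖u q‖ₑ ^ 2 := by
    intro k
    have hk : (0:ℝ) < 1 / ((k:ℝ) + 1) := by positivity
    set ε : ℝ := 1 / ((k:ℝ) + 1)
    have hv : volume (Ioo (0:ℝ) ε) = ENNReal.ofReal ε := by simp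
    have hv0 : volume (Ioo (0:ℝ) ε) ≠ 0 := by rw [hv]; simpa using hk
    have hv1 : volume (Ioo (0:ℝ) ε) ≠ ⊤ := by rw [hv]; simp
    obtain ⟨t, ht, hle⟩ := exists_le_setLAverage hv0 hv1 hGm.aemeasurable
    refine ⟨t, ht, hle.trans ?_⟩
    rw [setLAverage_eq]
    have := stepA n f hf P hP u hu hu2 ε hk
    rw [← hv] at this
    refine ENNReal.div_le_of_le_mul (this.trans (le_of_eq (by ring)))
  choose t ht hle using h1
  have ht0 : Tendsto t atTop (𝓝 0) :=
    squeeze_zero (fun k => (ht k).1.le) (fun k => (ht k).2.le) tendsto_one_div_add_atTop_nhds_zero_nat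
  calc ∫⁻ q, ‖Hc n f u 0 q‖ₑ ^ 2
      = ∫⁻ q, liminf (fun k => ‖Hc n f u (t k) q‖ₑ ^ 2) atTop := by
        refine lintegral_congr_ae ?_
        filter_upwards [stepB n f hf hf' u hu hu2] with q hq
        obtain ⟨b, hb, hbd⟩ := hq
        have hT : Tendsto (fun k => Hc n f u (t k) q) atTop (𝓝 (Hc n f u 0 q)) := by
          refine tendsto_integral_of_dominated_convergence b (fun k => ?_) hb
            (fun k => Eventually.of_forall fun w => hbd _ w) (Eventually.of_forall fun w => ?_)
          · exact ((hf.measurable.comp (by fun_prop)).mul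
              (hu.comp (by fun_prop))).aestronglyMeasurable
          · refine Tendsto.mul_const _ ?_
            exact ((hf.comp (by fun_prop : Continuous fun s : ℝ =>
              ((q.1, s), q.2 - w))).tendsto 0).comp ht0
        exact ((ENNReal.continuous_pow 2).tendsto _ |>.comp hT.enorm).liminf_eq.symm
    _ ≤ liminf (fun k => ∫⁻ q, ‖Hc n f u (t k) q‖ₑ ^ 2) atTop :=
        lintegral_liminf_le fun k => (hHt _).enorm.pow_const 2
    _ ≤ liminf (fun k : ℕ => ‖P‖ₑ ^ 2 * ∫⁻ q, ‖u q‖ₑ ^ 2) atTop :=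
        liminf_le_liminf (Eventually.of_forall hle)
    _ = _ := by simp

/-- For every `f ∈ C_c^∞(ℝⁿ×ℝⁿ)`, `‖π₀^∂(f⊕0)‖ ≤ ‖π₀(f)‖`: the norm of the boundary
half-convolution operator is bounded by the norm of the full fiberwise convolution
operator. -/
theorem statement17 (n : ℕ) (hn : 1 ≤ n) (f : Ef n × Ef n → ℂ)
    (hf : ContDiff ℝ ∞ f) (hf' : HasCompactSupport f)
    (P : HT n →L[ℂ] HT n) (hP : pi0Spec n f P)
    (B₀ : HB n →L[ℂ] HB n) (hB₀ : piBSpec n f (fun _ => 0) B₀) :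
    ‖B₀‖ ≤ ‖P‖ := by

  have hfc := hf.continuous
  refine ContinuousLinearMap.opNorm_le_bound _ (norm_nonneg _) fun ξ => ?_
  set S : Set (Eb n × Ef n) := {q | 0 ≤ q.2.2} with hS
  have hSm : MeasurableSet S :=
    measurableSet_Ici.preimage (by fun_prop : Measurable fun q : Eb n × Ef n => q.2.2)
  have hξm : Measurable (ξ : Eb n × Ef n → ℂ) := (Lp.stronglyMeasurable ξ).measurable
  set u : Eb n × Ef n → ℂ := S.indicator ξ with hu
  have hum : Measurable u := hξm.indicator hSm
  have hun : ∫⁻ q, ‖u q‖ₑ ^ 2 = ‖ξ‖ₑ ^ 2 := by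
    rw [Lp.enorm_def, eLpNorm_two_sq]
    change _ = ∫⁻ q in S, ‖ξ q‖ₑ ^ 2
    rw [← lintegral_indicator hSm]
    refine lintegral_congr fun q => ?_
    by_cases hq : q ∈ S <;> simp [hu, hq]
  have hu2 : ∫⁻ q, ‖u q‖ₑ ^ 2 ≠ ⊤ := by rw [hun]; simp
  have hC := stepC n f hfc hf' P hP u hum hu2
  have hBe : ⇑(B₀ ξ) =ᵐ[muB n] fun q => Hc n f u 0 q := by
    have hb : ∀ᵐ q ∂(muB n), ∃ b : Ef n → ℝ, Integrable b ∧
      ∀ t w, ‖f ((q.1, t), q.2 - w) * u (q.1, w)‖ ≤ b w :=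
      ae_restrict_of_ae (stepB n f hfc hf' u hum hu2)
    filter_upwards [hB₀ ξ, hb] with q hq1 ⟨b, hbi, hbd⟩
    rw [hq1, Hc]
    have hint : Integrable (fun w : Ef n => f ((q.1, 0), q.2 - w) * u (q.1, w)) := by
      refine hbi.mono' ?_ (Eventually.of_forall fun w => hbd 0 w)
      exact ((hfc.measurable.comp (by fun_prop)).mul
              (hum.comp (by fun_prop))).aestronglyMeasurable
    rw [Measure.volume_eq_prod, integral_prod _ hint]
    refine integral_congr_ae (Eventually.of_forall fun w' => ?_)
    simp only
    rw [← setIntegral_congr_set (Ioi_ae_eq_Ici (a := (0:ℝ)) (μ := volume)).symm,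
      ← integral_indicator measurableSet_Ici]
    refine integral_congr_ae (Eventually.of_forall fun wn => ?_)
    by_cases h : 0 ≤ wn
    · have h' : ((q.1, (w', wn)) : Eb n × Ef n) ∈ S := h
      have h2 : wn ∈ Ici (0:ℝ) := h
      simp only [hu, indicator_of_mem h', indicator_of_mem h2, add_zero]
      rfl
    · have h' : ((q.1, (w', wn)) : Eb n × Ef n) ∉ S := h
      have h2 : wn ∉ Ici (0:ℝ) := h
      simp only [hu, indicator_of_notMem h', indicator_of_notMem h2, mul_zero]
  have hfin : ‖B₀ ξ‖ₑ ^ 2 ≤ (‖P‖ₑ * ‖ξ‖ₑ) ^ 2 := by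
    rw [mul_pow, ← hun]
    refine le_trans ?_ hC
    rw [Lp.enorm_def, eLpNorm_congr_ae hBe, eLpNorm_two_sq]
    exact setLIntegral_le_lintegral _ _
  have h3 : ‖B₀ ξ‖ₑ ≤ ‖P‖ₑ * ‖ξ‖ₑ := (ENNReal.pow_le_pow_left_iff two_ne_zero).1 hfin
  rw [← toReal_enorm (B₀ ξ), ← toReal_enorm P, ← toReal_enorm ξ, ← ENNReal.toReal_mul]
  exact ENNReal.toReal_mono (by finiteness) h3
end
end
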